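/- arXiv:2312.03300 — 7 statements merged into one kernel-verified Lean document; each statement's English description precedes it below -/
import Mathlib

section
/- Let n ≥ 1, let A and D be arbitrary n×n matrices over ℂ, and let M be the 2n×2n block matrix M = [[0, D − I_n], [−I_n, A]]. Then for every z ∈ ℂ, det(z·I_{2n} − M) = det(z²·I_n − z·A + D − I_n). -/
open Matrix

/-- Ihara–Bass determinant reduction, graph case.
For arbitrary `n × n` complex matrices `A` and `D` and the `2n × 2n` block matrix
`M = [[0, D − I], [−I, A]]`, one has
`det(z·I − M) = det(z²·I − z·A + D − I)` for every `z ∈ ℂ`. -/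
theorem ihara_bass_reduction (n : ℕ) (hn : 1 ≤ n) (A D : Matrix (Fin n) (Fin n) ℂ)
    (M : Matrix (Fin n ⊕ Fin n) (Fin n ⊕ Fin n) ℂ)
    (hM : M = Matrix.fromBlocks 0 (D - 1) (-1) A) :
    ∀ z : ℂ,
      (z • (1 : Matrix (Fin n ⊕ Fin n) (Fin n ⊕ Fin n) ℂ) - M).det
        = ((z ^ 2) • (1 : Matrix (Fin n) (Fin n) ℂ) - z • A + D - 1).det := by
  intro z
  subst hM
  have key : (z • (1 : Matrix (Fin n ⊕ Fin n) (Fin n ⊕ Fin n) ℂ) -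
        fromBlocks 0 (D - 1) (-1) A) * fromBlocks 1 (A - z • 1 + 1) 0 1 =
      fromBlocks (z • 1) (z • 1 - ((z ^ 2) • 1 - z • A + D - 1)) 1 1 := by
    rw [← fromBlocks_one, fromBlocks_smul, sub_eq_add_neg, fromBlocks_neg, fromBlocks_add,
      fromBlocks_multiply]
    congr 1
    · simp
    · simp only [smul_zero, zero_add, sub_zero, ← sub_eq_add_neg, neg_sub, Matrix.smul_mul,
        Matrix.one_mul, Matrix.mul_one, smul_add, smul_sub, smul_smul, pow_two]
      abel
    · simp
    · simp only [smul_zero, zero_add, neg_neg, Matrix.one_mul, Matrix.mul_one]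
      abel
  have hdet := congrArg det key
  rw [det_mul, det_fromBlocks_zero₂₁, det_fromBlocks_one₂₂] at hdet
  simpa using hdet
end

section
/- Let n ≥ 1 and k ∈ ℂ, let A and D be arbitrary n×n matrices over ℂ, and let M be the 2n×2n block matrix M = [[0, D − I_n], [−(k−1)·I_n, A − (k−2)·I_n]]. Then for every z ∈ ℂ, det(z·I_{2n} − M) = det(z²·I_n + (k−2)z·I_n − z·A + (k−1)(D − I_n)). -/
open Matrix

/-- The swap block matrix with a sign has determinant one. -/
theorem det_fromBlocks_zero_one_neg_one_zero {m R : Type*} [Fintype m] [DecidableEq m]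
    [CommRing R] :
    (fromBlocks 0 1 (-1) 0 : Matrix (m ⊕ m) (m ⊕ m) R).det = 1 := by
  have h : (fromBlocks 0 1 (-1) 0 : Matrix (m ⊕ m) (m ⊕ m) R) =
      fromBlocks 1 1 0 1 * fromBlocks 1 1 (-1) 0 := by
    simp [fromBlocks_multiply]
  rw [h, det_mul, det_fromBlocks_zero₂₁, det_fromBlocks_one₁₁]
  simp

theorem det_fromBlocks_zero₁₁ {m R : Type*} [Fintype m] [DecidableEq m] [CommRing R]
    (B C E : Matrix m m R) :
    (fromBlocks 0 B C E).det = (-(C * B)).det := by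
  have h : fromBlocks 0 B C E = fromBlocks B 0 E (-C) * fromBlocks 0 1 (-1) 0 := by
    simp [fromBlocks_multiply]
  rw [h, det_mul, det_fromBlocks_zero₁₂, det_fromBlocks_zero_one_neg_one_zero, mul_one,
    ← Matrix.neg_mul, det_mul, mul_comm]

/-- The determinant of a square block matrix with square blocks whose top left block is scalar. -/
theorem det_fromBlocks_smul_one₁₁ {m K : Type*} [Fintype m] [DecidableEq m] [Field K]
    (c : K) (B C E : Matrix m m K) :
    (fromBlocks (c • 1) B C E).det = (c • E - C * B).det := by
  obtain rfl | hc := eq_or_ne c 0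
  · simp [det_fromBlocks_zero₁₁]
  · have h : fromBlocks 1 0 (-C) (c • 1) * fromBlocks (c • 1) B C E =
        fromBlocks (c • 1) B 0 (c • E - C * B) := by
      simp [fromBlocks_multiply, sub_eq_neg_add]
    have hdet := congrArg det h
    rw [det_mul, det_fromBlocks_zero₁₂, det_fromBlocks_zero₂₁, det_one, one_mul] at hdet
    refine mul_left_cancel₀ ?_ hdet
    simp [hc]

/-- Ihara–Bass determinant reduction, hypergraph case.
For arbitrary `n × n` complex matrices `A` and `D`, `k ∈ ℂ`, and the `2n × 2n` block matrix
`M = [[0, D − I], [−(k−1)·I, A − (k−2)·I]]`, one has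
`det(z·I − M) = det(z²·I + (k−2)z·I − z·A + (k−1)(D − I))` for every `z ∈ ℂ`. -/
theorem ihara_bass_reduction_hypergraph (n : ℕ) (hn : 1 ≤ n) (k : ℂ)
    (A D : Matrix (Fin n) (Fin n) ℂ)
    (M : Matrix (Fin n ⊕ Fin n) (Fin n ⊕ Fin n) ℂ)
    (hM : M = Matrix.fromBlocks 0 (D - 1) (-((k - 1) • (1 : Matrix (Fin n) (Fin n) ℂ)))
      (A - (k - 2) • (1 : Matrix (Fin n) (Fin n) ℂ))) :
    ∀ z : ℂ,
      (z • (1 : Matrix (Fin n ⊕ Fin n) (Fin n ⊕ Fin n) ℂ) - M).det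
        = ((z ^ 2) • (1 : Matrix (Fin n) (Fin n) ℂ) + ((k - 2) * z) • (1 : Matrix (Fin n) (Fin n) ℂ)
            - z • A + (k - 1) • (D - 1)).det := by
  intro z
  have h : z • (1 : Matrix (Fin n ⊕ Fin n) (Fin n ⊕ Fin n) ℂ) - M =
      fromBlocks (z • 1) (-(D - 1)) ((k - 1) • 1) (z • 1 - (A - (k - 2) • 1)) := by
    rw [hM, ← fromBlocks_one, fromBlocks_smul, sub_eq_add_neg, fromBlocks_neg, fromBlocks_add]
    simp [sub_eq_add_neg]
  rw [h, det_fromBlocks_smul_one₁₁]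
  congr 1
  rw [smul_mul_assoc, one_mul]
  module
end

section
/- Fix an integer d ≥ 3. For each n with nd even, let G_n be a uniformly random d-regular simple graph on n vertices, let \tilde B_n = [[0, (d−1)I_n], [−I_n, A_n]] where A_n is the adjacency matrix of G_n, let x_1, …, x_{2n} be the real parts of the 2n complex eigenvalues of \tilde B_n (with multiplicity, as roots of its characteristic polynomial), and let μ_n = (1/2n) Σ_{i=1}^{2n} δ_{x_i} be their empirical measure. Then μ_n converges weakly in probability, as n → ∞ along integers with nd even, to the rescaled Kesten–McKay distribution with density μ_KM(x) = 2d√((d−1) − x²) / (π(d² − 4x²)) on {|x| ≤ √(d−1)}; i.e., for every bounded continuous f : ℝ → ℝ and every ε > 0, P( | (1/2n) Σ_i f(x_i) − ∫ f(x) μ_KM(x) dx | > ε ) → 0. -/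
open Matrix MeasureTheory Filter

/-- `G` is a `d`-regular simple graph. -/
def IsReg {n : ℕ} (d : ℕ) (G : SimpleGraph (Fin n)) : Prop :=
  letI := Classical.decRel G.Adj
  G.IsRegularOfDegree d

/-- The reduced non-backtracking matrix `\tilde B = [[0, (d−1)I], [−I, A]]` of a graph `G`
on `n` vertices, viewed as a `d`-regular graph. -/
noncomputable def tildeB {n : ℕ} (d : ℕ) (G : SimpleGraph (Fin n)) :
    Matrix (Fin n ⊕ Fin n) (Fin n ⊕ Fin n) ℂ :=
  letI := Classical.decRel G.Adj
  Matrix.fromBlocks 0 (((d : ℂ) - 1) • (1 : Matrix (Fin n) (Fin n) ℂ)) (-1) (G.adjMatrix ℂ)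

/-- The empirical average `(1/2n) ∑_{i=1}^{2n} f(x_i)`, where `x_1, …, x_{2n}` are the real
parts of the `2n` complex eigenvalues of `\tilde B` (with multiplicity, as roots of its
characteristic polynomial). -/
noncomputable def empAvgRe {n : ℕ} (d : ℕ) (G : SimpleGraph (Fin n)) (f : ℝ → ℝ) : ℝ :=
  (((tildeB d G).charpoly.roots).map (fun z => f z.re)).sum / (2 * n)

open Polynomial in
theorem Matrix.IsHermitian.trace_aeval_eq_sum {V : Type*} [Fintype V] [DecidableEq V]
    {A : Matrix V V ℝ} (hA : A.IsHermitian) (P : ℝ[X]) :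
    (aeval A P).trace = ∑ i, P.eval (hA.eigenvalues i) := by
  conv_lhs => rw [hA.spectral_theorem]
  rw [show (Unitary.conjStarAlgAut ℝ (Matrix V V ℝ) hA.eigenvectorUnitary)
    (diagonal (RCLike.ofReal ∘ hA.eigenvalues)) =
      (((Unitary.conjStarAlgAut ℝ (Matrix V V ℝ) hA.eigenvectorUnitary).toAlgEquiv :
      Matrix V V ℝ ≃ₐ[ℝ] Matrix V V ℝ) : Matrix V V ℝ →ₐ[ℝ] Matrix V V ℝ)
      (diagonalAlgHom ℝ (RCLike.ofReal ∘ hA.eigenvalues)) from rfl]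
  rw [aeval_algHom_apply, aeval_algHom_apply]
  change (Unitary.conjStarAlgAut ℝ (Matrix V V ℝ) hA.eigenvectorUnitary (diagonal _)).trace = _
  rw [Unitary.conjStarAlgAut_apply, trace_mul_cycle]
  simp [trace, Polynomial.aeval_pi, Polynomial.coe_aeval_eq_eval]

theorem abs_eigenvalue_adjMatrix_le {V : Type*} [Fintype V] [DecidableEq V] {G : SimpleGraph V}
    [DecidableRel G.Adj] {d : ℕ} (hG : G.IsRegularOfDegree d)
    (hA : (G.adjMatrix ℝ).IsHermitian) (i : V) : |hA.eigenvalues i| ≤ d := by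
  have h1 : Module.End.HasEigenvalue (Matrix.toLin' (G.adjMatrix ℝ)) (hA.eigenvalues i) := by
    rw [Module.End.hasEigenvalue_iff_mem_spectrum, Matrix.spectrum_toLin']
    exact hA.eigenvalues_mem_spectrum_real i
  obtain ⟨k, hk⟩ := eigenvalue_mem_ball h1
  simp only [SimpleGraph.adjMatrix_apply, SimpleGraph.irrefl, if_false,
    Metric.mem_closedBall, dist_zero_right, Real.norm_eq_abs] at hk
  refine hk.trans ?_
  calc _ ≤ ∑ j, |if G.Adj k j then (1 : ℝ) else 0| :=
        Finset.sum_le_sum_of_subset_of_nonneg (Finset.erase_subset _ _) (fun _ _ _ => abs_nonneg _)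
    _ = d := by
        rw [← hG k]
        simp [apply_ite abs, SimpleGraph.card_neighborFinset_eq_degree,
          ← SimpleGraph.neighborFinset_eq_filter]

open Polynomial in
theorem charpoly_companion_eq_prod {V : Type*} [Fintype V] [DecidableEq V]
    {A : Matrix V V ℝ} (hA : A.IsHermitian) (q : ℂ) :
    (Matrix.fromBlocks 0 (q • (1 : Matrix V V ℂ)) (-1) (A.map Complex.ofReal)).charpoly =
      ∏ i, (X ^ 2 - C (hA.eigenvalues i : ℂ) * X + C q) := by
  apply Polynomial.eq_of_infinite_eval_eq
  refine Set.Infinite.mono (s := {0}ᶜ) ?_ (Set.finite_singleton _).infinite_compl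
  intro z hz
  have hz : z ≠ 0 := hz
  have hinv : Invertible (z • (1 : Matrix V V ℂ)) :=
    ⟨z⁻¹ • 1, by simp [smul_smul, hz], by simp [smul_smul, hz]⟩
  have hmap : (A.map Complex.ofReal).charpoly = ∏ i, (X - C (hA.eigenvalues i : ℂ)) := by
    have := Matrix.charpoly_map A Complex.ofRealHom
    rw [hA.charpoly_eq, Polynomial.map_prod] at this
    change (A.map Complex.ofRealHom).charpoly = _
    simpa using this
  rw [Set.mem_ofPred_eq, Matrix.eval_charpoly]
  have hb : Matrix.scalar (V ⊕ V) z -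
      Matrix.fromBlocks 0 (q • (1 : Matrix V V ℂ)) (-1) (A.map Complex.ofReal) =
      Matrix.fromBlocks (z • 1) (-(q • 1)) 1 (z • 1 - A.map Complex.ofReal) := by
    ext (i | i) (j | j) <;> simp [Matrix.scalar_apply, Matrix.diagonal_apply, Matrix.one_apply]
  rw [hb, Matrix.det_fromBlocks₁₁]
  have hi : ⅟ (z • (1 : Matrix V V ℂ)) = z⁻¹ • 1 :=
    invOf_eq_right_inv (by simp [smul_smul, hz])
  have hs : (z • 1 - A.map Complex.ofReal - 1 * ⅟ (z • (1 : Matrix V V ℂ)) * -(q • 1)) =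
      Matrix.scalar V (z + z⁻¹ * q) - A.map Complex.ofReal := by
    rw [hi]
    ext i j
    by_cases h : i = j <;> simp [h] <;> ring
  rw [hs, ← Matrix.eval_charpoly, hmap, Polynomial.eval_prod, Polynomial.eval_prod,
    Matrix.det_smul, Matrix.det_one, mul_one, Fintype.card, ← Finset.prod_const,
    ← Finset.prod_mul_distrib]
  refine Finset.prod_congr rfl fun i _ => ?_
  simp
  field_simp
  ring

open Polynomial in
theorem roots_quadratic_eq (l q : ℝ) :
    (X ^ 2 - C (l : ℂ) * X + C (q : ℂ)).roots.map Complex.re =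
      {(l + Real.sqrt (l ^ 2 - 4 * q)) / 2, (l - Real.sqrt (l ^ 2 - 4 * q)) / 2} := by
  set s : ℂ := Real.sqrt (l ^ 2 - 4 * q) + Real.sqrt (4 * q - l ^ 2) * Complex.I with hs
  have hs2 : s ^ 2 = l ^ 2 - 4 * q := by
    rcases le_total (4 * q) (l ^ 2) with h | h
    · rw [hs, Real.sqrt_eq_zero_of_nonpos (x := 4 * q - l ^ 2) (by linarith)]
      simp only [Complex.ofReal_zero, zero_mul, add_zero]
      rw [← Complex.ofReal_pow, Real.sq_sqrt (by linarith)]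
      push_cast; ring
    · rw [hs, Real.sqrt_eq_zero_of_nonpos (x := l ^ 2 - 4 * q) (by linarith)]
      simp only [Complex.ofReal_zero, zero_add]
      rw [mul_pow, ← Complex.ofReal_pow, Real.sq_sqrt (by linarith), Complex.I_sq]
      push_cast; ring
  have hf : (X ^ 2 - C (l : ℂ) * X + C (q : ℂ)) = (X - C ((l + s) / 2)) * (X - C ((l - s) / 2)) := by
    have h1 : (l : ℂ) = (l + s) / 2 + (l - s) / 2 := by ring
    have h2 : (q : ℂ) = (l + s) / 2 * ((l - s) / 2) := by linear_combination hs2 / 4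
    generalize (l + s) / 2 = u at *
    generalize (l - s) / 2 = v at *
    rw [h1, h2]; simp only [C_add, C_mul]; ring
  rw [hf, roots_mul (mul_ne_zero (X_sub_C_ne_zero _) (X_sub_C_ne_zero _)), roots_X_sub_C,
    roots_X_sub_C]
  simp [hs]

/-- The average of `f` over the real parts of the two roots of `z² - l z + q`. -/
noncomputable def rootReAvg (q : ℝ) (f : ℝ → ℝ) (l : ℝ) : ℝ :=
  (f ((l + Real.sqrt (l ^ 2 - 4 * q)) / 2) + f ((l - Real.sqrt (l ^ 2 - 4 * q)) / 2)) / 2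

theorem continuous_rootReAvg (q : ℝ) {f : ℝ → ℝ} (hf : Continuous f) :
    Continuous (rootReAvg q f) := by
  unfold rootReAvg
  fun_prop

theorem rootReAvg_of_sq_le {q l : ℝ} (f : ℝ → ℝ) (h : l ^ 2 ≤ 4 * q) :
    rootReAvg q f l = f (l / 2) := by
  rw [rootReAvg, Real.sqrt_eq_zero_of_nonpos (by linarith)]
  simp

open Classical in
theorem empAvgRe_eq {n : ℕ} (d : ℕ) (G : SimpleGraph (Fin n)) (f : ℝ → ℝ)
    (hA : (G.adjMatrix ℝ).IsHermitian) :
    empAvgRe d G f = (∑ i, rootReAvg (d - 1) f (hA.eigenvalues i)) / n := by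
  have hB : tildeB d G = Matrix.fromBlocks 0 ((((d : ℝ) - 1 : ℝ) : ℂ) • (1 : Matrix _ _ ℂ)) (-1)
      ((G.adjMatrix ℝ).map Complex.ofReal) := by
    unfold tildeB
    congr 1
    · simp
    · ext i j
      simp only [SimpleGraph.adjMatrix_apply, Matrix.map_apply]
      split_ifs <;> simp_all
  have hne : ∏ i, (Polynomial.X ^ 2 - Polynomial.C (hA.eigenvalues i : ℂ) * Polynomial.X +
      Polynomial.C (((d : ℝ) - 1 : ℝ) : ℂ)) ≠ 0 := by
    rw [← charpoly_companion_eq_prod]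
    exact (Matrix.charpoly_monic _).ne_zero
  rw [empAvgRe, hB, charpoly_companion_eq_prod hA, Polynomial.roots_prod _ _ hne,
    Multiset.map_bind, Multiset.sum_bind]
  have key : ∀ i, (((Polynomial.X ^ 2 - Polynomial.C (hA.eigenvalues i : ℂ) * Polynomial.X +
      Polynomial.C (((d : ℝ) - 1 : ℝ) : ℂ)).roots.map (fun z : ℂ => f z.re))).sum =
      2 * rootReAvg (d - 1) f (hA.eigenvalues i) := by
    intro i
    have := congrArg (fun s => (Multiset.map f s).sum)
      (roots_quadratic_eq (hA.eigenvalues i) (d - 1))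
    simp only [Multiset.map_map, Function.comp_def] at this
    rw [this]
    simp [rootReAvg]
    ring
  simp only [key]
  change (∑ i, 2 * _) / _ = _
  rw [← Finset.mul_sum, mul_div_mul_left _ _ two_ne_zero]

open Polynomial in
/-- The polynomials that send the adjacency matrix of a `(q + 1)`-regular graph to the matrices
counting its non-backtracking walks. -/
noncomputable def nbPoly (q : ℝ) : ℕ → ℝ[X]
  | 0 => 1
  | 1 => X
  | 2 => X ^ 2 - C (q + 1)
  | k + 3 => X * nbPoly q (k + 2) - C q * nbPoly q (k + 1)

open Polynomial in
theorem span_range_nbPoly (q : ℝ) : Submodule.span ℝ (Set.range (nbPoly q)) = ⊤ := by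
  set S := Submodule.span ℝ (Set.range (nbPoly q)) with hS
  have hmem : ∀ k, nbPoly q k ∈ S := fun k => Submodule.subset_span ⟨k, rfl⟩
  have hX : ∀ p ∈ S, X * p ∈ S := by
    intro p hp
    induction hp using Submodule.span_induction with
    | mem x hx =>
      obtain ⟨k, rfl⟩ := hx
      match k with
      | 0 => simpa [nbPoly] using hmem 1
      | 1 =>
        have : X * nbPoly q 1 = nbPoly q 2 + (q + 1) • nbPoly q 0 := by
          simp [nbPoly, smul_eq_C_mul]; ring
        rw [this]
        exact S.add_mem (hmem 2) (S.smul_mem _ (hmem 0))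
      | k + 2 =>
        have : X * nbPoly q (k + 2) = nbPoly q (k + 3) + q • nbPoly q (k + 1) := by
          rw [nbPoly, smul_eq_C_mul]; ring
        rw [this]
        exact S.add_mem (hmem _) (S.smul_mem _ (hmem _))
    | zero => simp
    | add x y _ _ hx hy => rw [mul_add]; exact S.add_mem hx hy
    | smul a x _ hx => rw [mul_smul_comm]; exact S.smul_mem _ hx
  have hXn : ∀ n : ℕ, (X ^ n : ℝ[X]) ∈ S := by
    intro n
    induction n with
    | zero => simpa [nbPoly] using hmem 0
    | succ n ih => rw [pow_succ']; exact hX _ ih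
  refine eq_top_iff.mpr fun p _ => ?_
  induction p using Polynomial.induction_on' with
  | add p r hp hr => exact S.add_mem (hp trivial) (hr trivial)
  | monomial n a =>
    rw [← C_mul_X_pow_eq_monomial, ← smul_eq_C_mul]
    exact S.smul_mem _ (hXn n)

theorem eval_nbPoly_mul_sin {q : ℝ} (hq : 0 < q) (θ : ℝ) (k : ℕ) :
    (nbPoly q (k + 1)).eval (2 * (Real.sqrt q * Real.cos θ)) * Real.sin θ =
      Real.sqrt q ^ (k + 1) * (Real.sin ((k + 2 : ℕ) * θ) - Real.sin (k * θ) / q) := by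
  have hs : Real.sqrt q ^ 2 = q := Real.sq_sqrt hq.le
  induction k using Nat.twoStepInduction with
  | zero =>
    simp [nbPoly, Real.sin_two_mul]; ring
  | one =>
    have h3 : Real.sin ((1 + 2 : ℕ) * θ) = Real.sin θ * (4 * Real.cos θ ^ 2 - 1) := by
      rw [show ((1 + 2 : ℕ) : ℝ) = 3 by norm_num, Real.sin_three_mul]
      linear_combination -4 * Real.sin θ * Real.sin_sq_add_cos_sq θ
    rw [h3]
    simp [nbPoly, mul_pow, hs]
    field_simp
    ring
  | more k ih1 ih2 =>
    have e1 : Real.sin ((k + 2 + 2 : ℕ) * θ) =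
        2 * Real.cos θ * Real.sin ((k + 1 + 2 : ℕ) * θ) - Real.sin ((k + 2 : ℕ) * θ) := by
      have h1 : ((k + 2 + 2 : ℕ) : ℝ) * θ = (k + 1 + 2 : ℕ) * θ + θ := by push_cast; ring
      have h2 : ((k + 2 : ℕ) : ℝ) * θ = (k + 1 + 2 : ℕ) * θ - θ := by push_cast; ring
      rw [h1, h2, Real.sin_add, Real.sin_sub]; ring
    have e2 : Real.sin ((k + 2 : ℕ) * θ) =
        2 * Real.cos θ * Real.sin ((k + 1 : ℕ) * θ) - Real.sin (k * θ) := by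
      have h1 : ((k + 2 : ℕ) : ℝ) * θ = (k + 1 : ℕ) * θ + θ := by push_cast; ring
      have h2 : (k : ℝ) * θ = (k + 1 : ℕ) * θ - θ := by push_cast; ring
      rw [h1, h2, Real.sin_add, Real.sin_sub]; ring
    have e3 : (nbPoly q (k + 2 + 1)).eval (2 * (Real.sqrt q * Real.cos θ)) * Real.sin θ =
        2 * (Real.sqrt q * Real.cos θ) *
          ((nbPoly q (k + 1 + 1)).eval (2 * (Real.sqrt q * Real.cos θ)) * Real.sin θ) -
          q * ((nbPoly q (k + 1)).eval (2 * (Real.sqrt q * Real.cos θ)) * Real.sin θ) := by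
      rw [show k + 2 + 1 = k + 3 from rfl, nbPoly]; simp; ring
    rw [e3, ih1, ih2, e1]
    nth_rewrite 3 [e2]
    set s := Real.sqrt q
    rw [← hs]
    have : s ≠ 0 := (Real.sqrt_pos.mpr hq).ne'
    field_simp
    ring

/-- The integrals `∫ sin θ sin (m θ) / |q - e^{2iθ}|²` over `[0, π]`. -/
noncomputable def kmTrig (q : ℝ) (m : ℕ) : ℝ :=
  ∫ θ in (0 : ℝ)..Real.pi,
    Real.sin θ * Real.sin (m * θ) / ((q + 1) ^ 2 - 4 * q * Real.cos θ ^ 2)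

theorem kmTrig_denom_ge {q : ℝ} (hq : 0 ≤ q) (θ : ℝ) :
    (q - 1) ^ 2 ≤ (q + 1) ^ 2 - 4 * q * Real.cos θ ^ 2 := by
  nlinarith [Real.cos_sq_le_one θ]

theorem kmTrig_denom_pos {q : ℝ} (hq : 1 < q) (θ : ℝ) :
    0 < (q + 1) ^ 2 - 4 * q * Real.cos θ ^ 2 :=
  lt_of_lt_of_le (by nlinarith [sq_nonneg (q - 1)]) (kmTrig_denom_ge (by linarith) θ)

theorem continuous_kmTrig_integrand {q : ℝ} (hq : 1 < q) (m : ℕ) :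
    Continuous fun θ : ℝ =>
      Real.sin θ * Real.sin (m * θ) / ((q + 1) ^ 2 - 4 * q * Real.cos θ ^ 2) :=
  Continuous.div (by fun_prop) (by fun_prop) fun θ => (kmTrig_denom_pos hq θ).ne'

theorem abs_kmTrig_le {q : ℝ} (hq : 1 < q) (m : ℕ) :
    |kmTrig q m| ≤ 1 / (q - 1) ^ 2 * Real.pi := by
  have hpos : 0 < (q - 1) ^ 2 := by nlinarith
  have := intervalIntegral.norm_integral_le_of_norm_le_const (a := 0) (b := Real.pi)
    (C := 1 / (q - 1) ^ 2)
    (f := fun θ : ℝ => Real.sin θ * Real.sin (m * θ) / ((q + 1) ^ 2 - 4 * q * Real.cos θ ^ 2))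
    (fun θ _ => by
      rw [Real.norm_eq_abs, abs_div, abs_mul, abs_of_pos (kmTrig_denom_pos hq θ)]
      refine div_le_div₀ zero_le_one ?_ hpos (kmTrig_denom_ge (by linarith) θ)
      exact mul_le_one₀ (Real.abs_sin_le_one _) (abs_nonneg _) (Real.abs_sin_le_one _))
  rwa [sub_zero, abs_of_pos Real.pi_pos] at this

theorem integral_sin_mul_sin_nat_eq_zero (m : ℕ) :
    ∫ θ in (0 : ℝ)..Real.pi, Real.sin θ * Real.sin ((m + 2 : ℕ) * θ) = 0 := by
  have hd : ∀ θ ∈ Set.uIcc 0 Real.pi, HasDerivAt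
      (fun θ : ℝ => (Real.sin ((m + 1 : ℕ) * θ) / (m + 1 : ℕ) -
        Real.sin ((m + 3 : ℕ) * θ) / (m + 3 : ℕ)) / 2)
      (Real.sin θ * Real.sin ((m + 2 : ℕ) * θ)) θ := by
    intro θ _
    have hs : ∀ k : ℕ, HasDerivAt (fun θ : ℝ => Real.sin ((k + 1 : ℕ) * θ) / (k + 1 : ℕ))
        (Real.cos ((k + 1 : ℕ) * θ)) θ := by
      intro k
      have h := ((((hasDerivAt_id θ).const_mul ((k + 1 : ℕ) : ℝ)).sin).div_const
        ((k + 1 : ℕ) : ℝ))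
      refine h.congr_deriv ?_
      have : ((k + 1 : ℕ) : ℝ) ≠ 0 := by positivity
      simp only [id, mul_one]
      field_simp
    refine (((hs m).sub (hs (m + 2))).div_const 2).congr_deriv ?_
    have h1 : ((m + 1 : ℕ) : ℝ) * θ = (m + 2 : ℕ) * θ - θ := by push_cast; ring
    have h2 : ((m + 2 + 1 : ℕ) : ℝ) * θ = (m + 2 : ℕ) * θ + θ := by push_cast; ring
    rw [h1, h2, Real.cos_add, Real.cos_sub]; ring
  rw [intervalIntegral.integral_eq_sub_of_hasDerivAt hd
    (Continuous.intervalIntegrable (by fun_prop) _ _), Real.sin_nat_mul_pi, Real.sin_nat_mul_pi]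
  simp

theorem kmTrig_recurrence {q : ℝ} (hq : 1 < q) (m : ℕ) :
    (q ^ 2 + 1) * kmTrig q (m + 2) - q * (kmTrig q (m + 4) + kmTrig q m) = 0 := by
  have hi := fun k => (continuous_kmTrig_integrand hq k).intervalIntegrable (μ := volume) 0 Real.pi
  unfold kmTrig
  rw [← intervalIntegral.integral_add (hi _) (hi _), ← intervalIntegral.integral_const_mul,
    ← intervalIntegral.integral_const_mul, ← intervalIntegral.integral_sub
    ((hi _).const_mul _) (((hi _).add (hi _)).const_mul _)]
  refine Eq.trans ?_ (integral_sin_mul_sin_nat_eq_zero m)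
  refine intervalIntegral.integral_congr fun θ _ => ?_
  have hD := (kmTrig_denom_pos hq θ).ne'
  have h1 : ((m + 4 : ℕ) : ℝ) * θ = (m + 2 : ℕ) * θ + 2 * θ := by push_cast; ring
  have h2 : (m : ℝ) * θ = (m + 2 : ℕ) * θ - 2 * θ := by push_cast; ring
  rw [h1, h2, Real.sin_add, Real.sin_sub, Real.cos_two_mul]
  rw [← add_div, ← mul_div_assoc, ← mul_div_assoc, ← sub_div, div_eq_iff hD]
  ring

theorem kmTrig_add_two {q : ℝ} (hq : 1 < q) (m : ℕ) : kmTrig q (m + 2) - kmTrig q m / q = 0 := by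
  have hq0 : q ≠ 0 := by linarith
  set T : ℕ → ℝ := fun m => kmTrig q (m + 2) - kmTrig q m / q with hT
  have hrec : ∀ m, T m = q⁻¹ * T (m + 2) := by
    intro m
    have := kmTrig_recurrence hq m
    simp only [hT]
    field_simp
    linear_combination this
  have hpow : ∀ j, T m = q⁻¹ ^ j * T (m + 2 * j) := by
    intro j
    induction j with
    | zero => simp
    | succ j ih => rw [ih, hrec, pow_succ, mul_assoc]; rfl
  obtain ⟨K, hK⟩ : ∃ K, ∀ m, |T m| ≤ K := by
    refine ⟨1 / (q - 1) ^ 2 * Real.pi + 1 / (q - 1) ^ 2 * Real.pi / q, fun m => ?_⟩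
    refine (abs_sub _ _).trans (add_le_add (abs_kmTrig_le hq _) ?_)
    rw [abs_div, abs_of_pos (show 0 < q by linarith)]
    exact div_le_div_of_nonneg_right (abs_kmTrig_le hq _) (by linarith)
  have hlim : Tendsto (fun j : ℕ => q⁻¹ ^ j * K) atTop (nhds 0) := by
    simpa using (tendsto_pow_atTop_nhds_zero_of_lt_one (inv_nonneg.mpr (by linarith))
      (inv_lt_one_of_one_lt₀ hq)).mul_const K
  have hle : |T m| ≤ 0 := ge_of_tendsto' hlim fun j => by
    rw [hpow j, abs_mul, abs_of_nonneg (by positivity)]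
    exact mul_le_mul_of_nonneg_left (hK _) (by positivity)
  exact abs_nonpos_iff.mp hle

theorem kmTrig_one {q : ℝ} (hq : 1 < q) : kmTrig q 1 = Real.pi / (2 * q * (q + 1)) := by
  have hi := fun k => (continuous_kmTrig_integrand hq k).intervalIntegrable (μ := volume) 0 Real.pi
  have h3 := kmTrig_add_two hq 1
  have key : (q ^ 2 + 1 + q) * kmTrig q 1 - q * kmTrig q 3 = Real.pi / 2 := by
    have hsq := integral_sin_sq (a := 0) (b := Real.pi)
    simp only [Real.sin_zero, Real.sin_pi, zero_mul, sub_zero, zero_add] at hsq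
    rw [← hsq]
    unfold kmTrig
    rw [← intervalIntegral.integral_const_mul,
      ← intervalIntegral.integral_const_mul, ← intervalIntegral.integral_sub
      ((hi _).const_mul _) ((hi _).const_mul _)]
    refine intervalIntegral.integral_congr fun θ _ => ?_
    have hD := (kmTrig_denom_pos hq θ).ne'
    simp only [Nat.cast_one, one_mul, Nat.cast_ofNat]
    rw [Real.sin_three_mul]
    rw [← mul_div_assoc, ← mul_div_assoc, ← sub_div, div_eq_iff hD]
    linear_combination (4 * q * Real.sin θ ^ 2) * Real.sin_sq_add_cos_sq θ
  have hq0 : q ≠ 0 := by linarith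
  have hq1 : q + 1 ≠ 0 := by linarith
  field_simp
  field_simp at h3
  linear_combination 2 * key + 2 * h3

/-- The density of the rescaled Kesten–McKay law. -/
noncomputable def kmDensity (d : ℕ) (x : ℝ) : ℝ :=
  2 * (d : ℝ) * Real.sqrt (((d : ℝ) - 1) - x ^ 2) / (Real.pi * ((d : ℝ) ^ 2 - 4 * x ^ 2))

theorem kmDensity_denom_pos {d : ℕ} (hd : 3 ≤ d) {x : ℝ}
    (hx : x ∈ Set.Icc (-(Real.sqrt ((d : ℝ) - 1))) (Real.sqrt ((d : ℝ) - 1))) :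
    0 < (d : ℝ) ^ 2 - 4 * x ^ 2 := by
  have h3 : (3 : ℝ) ≤ d := by exact_mod_cast hd
  have : x ^ 2 ≤ (d : ℝ) - 1 := by
    rw [← Real.sq_sqrt (show (0 : ℝ) ≤ (d : ℝ) - 1 by linarith)]
    exact sq_le_sq' hx.1 hx.2
  nlinarith

theorem kmDensity_nonneg {d : ℕ} (hd : 3 ≤ d) {x : ℝ}
    (hx : x ∈ Set.Icc (-(Real.sqrt ((d : ℝ) - 1))) (Real.sqrt ((d : ℝ) - 1))) :
    0 ≤ kmDensity d x := by
  have := kmDensity_denom_pos hd hx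
  unfold kmDensity
  positivity

theorem continuousOn_kmDensity {d : ℕ} (hd : 3 ≤ d) :
    ContinuousOn (kmDensity d)
      (Set.Icc (-(Real.sqrt ((d : ℝ) - 1))) (Real.sqrt ((d : ℝ) - 1))) := by
  unfold kmDensity
  refine ContinuousOn.div (by fun_prop) (by fun_prop) fun x hx => ?_
  exact mul_ne_zero Real.pi_ne_zero (kmDensity_denom_pos hd hx).ne'

/-- Integration against the rescaled Kesten–McKay law. -/
noncomputable def kmInt (d : ℕ) (h : ℝ → ℝ) : ℝ :=
  ∫ x in Set.Icc (-(Real.sqrt ((d : ℝ) - 1))) (Real.sqrt ((d : ℝ) - 1)), h x * kmDensity d x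

theorem integrableOn_mul_kmDensity {d : ℕ} (hd : 3 ≤ d) {h : ℝ → ℝ} (hh : Continuous h) :
    IntegrableOn (fun x => h x * kmDensity d x)
      (Set.Icc (-(Real.sqrt ((d : ℝ) - 1))) (Real.sqrt ((d : ℝ) - 1))) :=
  (hh.continuousOn.mul (continuousOn_kmDensity hd)).integrableOn_Icc

theorem kmInt_eq_integral_trig {d : ℕ} (hd : 3 ≤ d) {h : ℝ → ℝ} (hh : Continuous h) :
    kmInt d h = 2 * d * ((d : ℝ) - 1) / Real.pi * ∫ θ in (0 : ℝ)..Real.pi,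
      h (Real.sqrt ((d : ℝ) - 1) * Real.cos θ) * Real.sin θ ^ 2 /
        ((d : ℝ) ^ 2 - 4 * ((d : ℝ) - 1) * Real.cos θ ^ 2) := by
  have h3 : (3 : ℝ) ≤ d := by exact_mod_cast hd
  set q : ℝ := (d : ℝ) - 1 with hq
  have hq0 : 0 ≤ q := by linarith
  set s := Real.sqrt q with hs
  have hs2 : s ^ 2 = q := Real.sq_sqrt hq0
  have hs0 : 0 ≤ s := Real.sqrt_nonneg _
  have hmaps : ∀ θ, s * Real.cos θ ∈ Set.Icc (-s) s := fun θ =>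
    ⟨by nlinarith [Real.neg_one_le_cos θ], by nlinarith [Real.cos_le_one θ]⟩
  have hsub := intervalIntegral.integral_comp_mul_deriv' (a := 0) (b := Real.pi)
    (f := fun θ => s * Real.cos θ) (f' := fun θ => s * -Real.sin θ)
    (g := fun x => h x * kmDensity d x)
    (fun θ _ => (Real.hasDerivAt_cos θ).const_mul s) (by fun_prop)
    ((hh.continuousOn.mul (continuousOn_kmDensity hd)).mono (by
      rintro _ ⟨θ, _, rfl⟩
      exact hmaps θ))
  simp only [Real.cos_zero, Real.cos_pi, mul_one, mul_neg] at hsub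
  rw [kmInt, integral_Icc_eq_integral_Ioc, ← hq, ← hs,
    ← intervalIntegral.integral_of_le (by linarith), intervalIntegral.integral_symm, ← hsub,
    ← intervalIntegral.integral_neg, ← intervalIntegral.integral_const_mul]
  refine intervalIntegral.integral_congr fun θ hθ => ?_
  rw [Set.uIcc_of_le Real.pi_pos.le] at hθ
  have hsin : 0 ≤ Real.sin θ := Real.sin_nonneg_of_mem_Icc hθ
  have hsq : Real.sqrt (q - (s * Real.cos θ) ^ 2) = s * Real.sin θ := by
    rw [← Real.sqrt_sq (mul_nonneg hs0 hsin)]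
    congr 1
    rw [← hs2]
    linear_combination -s ^ 2 * Real.sin_sq_add_cos_sq θ
  have hD : (d : ℝ) ^ 2 - 4 * q * Real.cos θ ^ 2 ≠ 0 := by
    have := kmDensity_denom_pos hd (hmaps θ)
    rw [mul_pow, hs2, ← mul_assoc] at this
    exact this.ne'
  simp only [Function.comp, kmDensity]
  rw [← hq, hsq, mul_pow, hs2]
  have hpi := Real.pi_ne_zero
  rw [← mul_assoc 4 q]
  field_simp
  rw [hs2]
  ring

theorem kmInt_one {d : ℕ} (hd : 3 ≤ d) : kmInt d (fun _ => 1) = 1 := by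
  have h3 : (3 : ℝ) ≤ d := by exact_mod_cast hd
  have h1 := kmTrig_one (q := (d : ℝ) - 1) (by linarith)
  rw [kmInt_eq_integral_trig hd continuous_const]
  simp only [kmTrig, Nat.cast_one, one_mul, sub_add_cancel, ← sq] at h1
  simp only [one_mul]
  rw [h1]
  have hpi := Real.pi_ne_zero
  have : (d : ℝ) - 1 ≠ 0 := by linarith
  field_simp

theorem kmInt_nbPoly {d : ℕ} (hd : 3 ≤ d) (k : ℕ) :
    kmInt d (fun x => (nbPoly (d - 1) (k + 1)).eval (2 * x)) = 0 := by
  have h3 : (3 : ℝ) ≤ d := by exact_mod_cast hd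
  have hq : (1 : ℝ) < (d : ℝ) - 1 := by linarith
  have hi := fun k => (continuous_kmTrig_integrand hq k).intervalIntegrable (μ := volume) 0 Real.pi
  have h1 := kmTrig_add_two hq k
  rw [kmInt_eq_integral_trig hd (by fun_prop)]
  refine mul_eq_zero_of_right _ ?_
  refine Eq.trans ?_ (mul_eq_zero_of_right (Real.sqrt ((d : ℝ) - 1) ^ (k + 1)) h1)
  rw [kmTrig, kmTrig, div_eq_inv_mul,
    ← intervalIntegral.integral_const_mul,
    ← intervalIntegral.integral_sub (hi _) ((hi _).const_mul _),
    ← intervalIntegral.integral_const_mul]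
  refine intervalIntegral.integral_congr fun θ _ => ?_
  have h2 := eval_nbPoly_mul_sin (show (0 : ℝ) < (d : ℝ) - 1 by linarith) θ k
  simp only [sub_add_cancel]
  rw [pow_two (Real.sin θ), ← mul_assoc, h2]
  ring

section Graph

open scoped Classical Finset

variable {V : Type*} [Fintype V]

/-- The neighbours of `v` in `G`. -/
noncomputable def nbrs (G : SimpleGraph V) (v : V) : Finset V := {w | G.Adj v w}

@[simp]
theorem mem_nbrs {G : SimpleGraph V} {v w : V} : w ∈ nbrs G v ↔ G.Adj v w := by simp [nbrs]

/-- The closed ball of radius `k` around `a` in the graph metric of `G`. -/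
noncomputable def gball (G : SimpleGraph V) (a : V) : ℕ → Finset V
  | 0 => {a}
  | k + 1 => (gball G a k).biUnion fun u => insert u (nbrs G u)

theorem mem_gball_succ {G : SimpleGraph V} {a v : V} {k : ℕ} :
    v ∈ gball G a (k + 1) ↔ ∃ u ∈ gball G a k, v = u ∨ G.Adj u v := by
  simp [gball]

theorem self_mem_gball (G : SimpleGraph V) (a : V) (k : ℕ) : a ∈ gball G a k := by
  induction k with
  | zero => simp [gball]
  | succ k ih => exact mem_gball_succ.mpr ⟨a, ih, Or.inl rfl⟩

theorem gball_mono_radius (G : SimpleGraph V) (a : V) : Monotone (gball G a) :=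
  monotone_nat_of_le_succ fun _ u hu => mem_gball_succ.mpr ⟨u, hu, Or.inl rfl⟩

theorem gball_mono {G H : SimpleGraph V} (h : H ≤ G) (a : V) (k : ℕ) :
    gball H a k ⊆ gball G a k := by
  induction k with
  | zero => simp [gball]
  | succ k ih =>
    intro v hv
    obtain ⟨u, hu, huv⟩ := mem_gball_succ.mp hv
    exact mem_gball_succ.mpr ⟨u, ih hu, huv.imp_right fun h' => h h'⟩

theorem mem_gball_of_walk {G : SimpleGraph V} (p : ℕ → V) (i l : ℕ)
    (hp : ∀ j, i ≤ j → j < i + l → G.Adj (p j) (p (j + 1))) : p (i + l) ∈ gball G (p i) l := by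
  induction l with
  | zero => simp [gball]
  | succ l ih =>
    exact mem_gball_succ.mpr ⟨_, ih fun j h1 h2 => hp j h1 (by omega),
      Or.inr (hp (i + l) (by omega) (by omega))⟩

/-- Every vertex of `G` has exactly `d` neighbours. -/
def NbrsCard (d : ℕ) (G : SimpleGraph V) : Prop := ∀ v, #(nbrs G v) = d

theorem NbrsCard.card_gball_le {d : ℕ} {G : SimpleGraph V} (hG : NbrsCard d G) (a : V) (k : ℕ) :
    #(gball G a k) ≤ (d + 1) ^ k := by
  induction k with
  | zero => simp [gball]
  | succ k ih =>
    rw [gball, pow_succ]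
    refine (Finset.card_biUnion_le_card_mul _ _ (d + 1) fun u _ => ?_).trans
      (Nat.mul_le_mul_right _ ih)
    exact (Finset.card_insert_le _ _).trans (by rw [hG u])

theorem NbrsCard.card_sigma_nbrs {d : ℕ} {G : SimpleGraph V} (hG : NbrsCard d G) (S : Finset V) :
    #(S.sigma fun v => nbrs G v) = #S * d := by
  rw [Finset.card_sigma, Finset.sum_congr rfl fun v _ => hG v]
  simp

/-- The oriented edges `(a, b)` of `G` that lie in a cycle of length at most `k + 1`. -/
noncomputable def shortEdges (k : ℕ) (G : SimpleGraph V) : Finset (V × V) :=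
  {e | G.Adj e.1 e.2 ∧ e.2 ∈ gball (G.deleteEdges {s(e.1, e.2)}) e.1 k}

/-- The oriented edges of `G` at distance more than `k` from `a`. -/
noncomputable def farEdges (k : ℕ) (G : SimpleGraph V) (a : V) : Finset (Σ _ : V, V) :=
  {e ∈ (gball G a k)ᶜ.sigma (fun v => nbrs G v) | e.2 ∉ gball G a k}

theorem NbrsCard.le_card_farEdges {d : ℕ} {G : SimpleGraph V} (hG : NbrsCard d G) (k : ℕ)
    (a : V) : Fintype.card V * d ≤ #(farEdges k G a) + 2 * ((d + 1) ^ k * d) := by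
  set B := (gball G a k).sigma (fun v => nbrs G v) with hB
  have hBc : #B ≤ (d + 1) ^ k * d := by
    rw [hB, hG.card_sigma_nbrs]
    exact Nat.mul_le_mul_right _ (hG.card_gball_le a k)
  have hsub : Finset.univ.sigma (fun v => nbrs G v) ⊆
      farEdges k G a ∪ (B ∪ B.image fun e => ⟨e.2, e.1⟩) := by
    rintro ⟨x, y⟩ hxy
    simp only [Finset.mem_sigma, Finset.mem_univ, true_and, mem_nbrs] at hxy
    simp only [farEdges, hB, Finset.mem_union, Finset.mem_filter, Finset.mem_sigma,
      Finset.mem_compl, mem_nbrs, Finset.mem_image]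
    by_cases hx : x ∈ gball G a k
    · exact Or.inr (Or.inl ⟨hx, hxy⟩)
    by_cases hy : y ∈ gball G a k
    · exact Or.inr (Or.inr ⟨⟨y, x⟩, ⟨hy, hxy.symm⟩, rfl⟩)
    · exact Or.inl ⟨⟨hx, hxy⟩, hy⟩
  have h1 := Finset.card_le_card hsub
  rw [hG.card_sigma_nbrs, Finset.card_univ] at h1
  have h2 := Finset.card_union_le (farEdges k G a) (B ∪ B.image fun e => ⟨e.2, e.1⟩)
  have h3 := Finset.card_union_le B (B.image fun e => (⟨e.2, e.1⟩ : Σ _ : V, V))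
  have h4 := Finset.card_image_le (s := B) (f := fun e => (⟨e.2, e.1⟩ : Σ _ : V, V))
  omega

/-- Replace the edges `ab` and `xy` by `ax` and `by` (or conversely). -/
def switchEdges {W : Type*} (G : SimpleGraph W) (a b x y : W) : SimpleGraph W :=
  symmDiff G (SimpleGraph.fromEdgeSet {s(a, b), s(x, y), s(a, x), s(b, y)})

theorem switchEdges_adj {W : Type*} {G : SimpleGraph W} {a b x y p r : W} :
    (switchEdges G a b x y).Adj p r ↔
      (G.Adj p r ∧ ¬((s(p, r) = s(a, b) ∨ s(p, r) = s(x, y) ∨ s(p, r) = s(a, x) ∨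
        s(p, r) = s(b, y)) ∧ p ≠ r)) ∨
      ((s(p, r) = s(a, b) ∨ s(p, r) = s(x, y) ∨ s(p, r) = s(a, x) ∨
        s(p, r) = s(b, y)) ∧ p ≠ r) ∧ ¬ G.Adj p r := by
  simp only [switchEdges, symmDiff_def, SimpleGraph.sup_adj, SimpleGraph.sdiff_adj,
    SimpleGraph.fromEdgeSet_adj, Set.mem_insert_iff, Set.mem_singleton_iff]

theorem switchEdges_injective {W : Type*} (a b x y : W) :
    Function.Injective fun G : SimpleGraph W => switchEdges G a b x y :=
  symmDiff_left_injective _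

theorem card_nbrs_eq_of_replace {G H : SimpleGraph V} {v p r : V} (hp : G.Adj v p)
    (hr : ¬ G.Adj v r) (h : ∀ w, H.Adj v w ↔ (G.Adj v w ∧ w ≠ p) ∨ w = r) :
    #(nbrs H v) = #(nbrs G v) := by
  have : nbrs H v = insert r ((nbrs G v).erase p) := by
    ext w
    simp only [mem_nbrs, h, Finset.mem_insert, Finset.mem_erase]
    tauto
  rw [this, Finset.card_insert_of_notMem (by simp [hr]),
    Finset.card_erase_add_one (by simpa using hp)]

theorem NbrsCard.switchEdges {d : ℕ} {G : SimpleGraph V} (hG : NbrsCard d G) {a b x y : V}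
    (hab : G.Adj a b) (hxy : G.Adj x y) (hax : ¬ G.Adj a x) (hby : ¬ G.Adj b y)
    (h1 : x ≠ a) (h2 : x ≠ b) (h3 : y ≠ a) (h4 : y ≠ b) :
    NbrsCard d (switchEdges G a b x y) := by
  have hab' := hab.ne
  have hxy' := hxy.ne
  intro v
  rw [← hG v]
  by_cases va : v = a
  · subst va
    refine card_nbrs_eq_of_replace hab hax fun w => ?_
    simp only [switchEdges_adj, Sym2.eq_iff]
    grind
  by_cases vb : v = b
  · subst vb
    refine card_nbrs_eq_of_replace hab.symm hby fun w => ?_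
    simp only [switchEdges_adj, Sym2.eq_iff]
    grind [SimpleGraph.Adj.symm]
  by_cases vx : v = x
  · subst vx
    refine card_nbrs_eq_of_replace hxy (fun h => hax h.symm) fun w => ?_
    simp only [switchEdges_adj, Sym2.eq_iff]
    grind [SimpleGraph.Adj.symm]
  by_cases vy : v = y
  · subst vy
    refine card_nbrs_eq_of_replace hxy.symm (fun h => hby h.symm) fun w => ?_
    simp only [switchEdges_adj, Sym2.eq_iff]
    grind [SimpleGraph.Adj.symm]
  congr 1
  ext w
  simp only [mem_nbrs, switchEdges_adj, Sym2.eq_iff]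
  grind

theorem gball_deleteEdges_subset_switchEdges {G : SimpleGraph V} {a b x y : V} {k : ℕ}
    (hax : ¬ G.Adj a x) (hby : ¬ G.Adj b y) (hx : x ∉ gball G a k) :
    gball (G.deleteEdges {s(a, b)}) a k ⊆ gball (switchEdges G a b x y) a k := by
  have hx' : ∀ j ≤ k, ∀ u ∈ gball (G.deleteEdges {s(a, b)}) a j, u ≠ x := by
    rintro j hj u hu rfl
    exact hx (gball_mono_radius G a hj (gball_mono (G.deleteEdges_le _) a j hu))
  have main : ∀ j ≤ k,
      gball (G.deleteEdges {s(a, b)}) a j ⊆ gball (switchEdges G a b x y) a j := by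
    intro j
    induction j with
    | zero => intro _; simp [gball]
    | succ j ih =>
      intro hj v hv
      have hvx := hx' _ hj v hv
      obtain ⟨u, hu, huv⟩ := mem_gball_succ.mp hv
      have hux := hx' j (by omega) u hu
      refine mem_gball_succ.mpr ⟨u, ih (by omega) hu, huv.imp_right fun h => ?_⟩
      simp only [SimpleGraph.deleteEdges_adj, Set.mem_singleton_iff] at h
      simp only [switchEdges_adj]
      have hne := h.1.ne
      simp only [Sym2.eq_iff] at h ⊢
      grind [SimpleGraph.Adj.symm]
  exact main k le_rfl

variable (V) in
/-- The `d`-regular graphs on the vertex set `V`. -/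
noncomputable def regGraphs (d : ℕ) : Finset (SimpleGraph V) := {G | NbrsCard d G}

theorem sum_card_shortEdges_mul_le (d k : ℕ) :
    (∑ G ∈ regGraphs V d, #(shortEdges k G)) * (Fintype.card V * d) ≤
      #(regGraphs V d) * (Fintype.card V * (d * ((d + 1) ^ k * d))) +
        (∑ G ∈ regGraphs V d, #(shortEdges k G)) * (2 * ((d + 1) ^ (k + 2) * d)) := by
  set P : Finset (Σ _ : SimpleGraph V, Σ _ : V × V, Σ _ : V, V) :=
    (regGraphs V d).sigma fun G => (shortEdges k G).sigma fun e => farEdges (k + 2) G e.1 with hP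
  set Q : Finset (Σ _ : SimpleGraph V, Σ _ : V, V × Σ _ : V, V) :=
    (regGraphs V d).sigma fun G => Finset.univ.sigma fun a =>
      nbrs G a ×ˢ (gball G a k).sigma fun b => nbrs G b with hQ
  have hQc : #Q ≤ #(regGraphs V d) * (Fintype.card V * (d * ((d + 1) ^ k * d))) := by
    rw [hQ, Finset.card_sigma]
    refine Finset.sum_le_card_nsmul _ _ _ fun G hG => ?_
    have hG : NbrsCard d G := by simpa [regGraphs] using hG
    rw [Finset.card_sigma]
    refine Finset.sum_le_card_nsmul _ _ _ fun a _ => ?_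
    rw [Finset.card_product, hG a, hG.card_sigma_nbrs]
    exact Nat.mul_le_mul_left _ (Nat.mul_le_mul_right _ (hG.card_gball_le a k))
  have hPc : (∑ G ∈ regGraphs V d, #(shortEdges k G)) * (Fintype.card V * d) ≤
      #P + (∑ G ∈ regGraphs V d, #(shortEdges k G)) * (2 * ((d + 1) ^ (k + 2) * d)) := by
    rw [hP, Finset.card_sigma, Finset.sum_mul, Finset.sum_mul, ← Finset.sum_add_distrib]
    refine Finset.sum_le_sum fun G hG => ?_
    have hG : NbrsCard d G := by simpa [regGraphs] using hG
    have := Finset.sum_le_sum (s := shortEdges k G) fun e _ => hG.le_card_farEdges (k + 2) e.1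
    rwa [Finset.sum_add_distrib, Finset.sum_const, Finset.sum_const, smul_eq_mul, smul_eq_mul,
      ← Finset.card_sigma] at this
  refine hPc.trans (Nat.add_le_add_right (le_trans ?_ hQc) _)
  have hfar : ∀ s ∈ P, NbrsCard d s.1 ∧ s.1.Adj s.2.1.1 s.2.1.2 ∧
      s.2.1.2 ∈ gball (s.1.deleteEdges {s(s.2.1.1, s.2.1.2)}) s.2.1.1 k ∧
      s.1.Adj s.2.2.1 s.2.2.2 ∧ s.2.2.1 ∉ gball s.1 s.2.1.1 (k + 2) ∧
      s.2.2.2 ∉ gball s.1 s.2.1.1 (k + 2) := by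
    rintro ⟨G, ⟨a, b⟩, x, y⟩ hs
    simp only [hP, regGraphs, shortEdges, farEdges, Finset.mem_sigma, Finset.mem_filter,
      Finset.mem_univ, true_and, Finset.mem_compl, mem_nbrs] at hs
    tauto
  refine Finset.card_le_card_of_injOn
    (fun s => ⟨switchEdges s.1 s.2.1.1 s.2.1.2 s.2.2.1 s.2.2.2, s.2.1.1, s.2.2.1, s.2.1.2,
      s.2.2.2⟩) ?_ ?_
  · rintro ⟨G, ⟨a, b⟩, x, y⟩ hs
    obtain ⟨hG, hab, hb, hxy, hx, hy⟩ := hfar _ hs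
    dsimp only at hG hab hb hxy hx hy
    have mem0 : a ∈ gball G a k := self_mem_gball G a k
    have mem1 : ∀ {v}, G.Adj a v → v ∈ gball G a (k + 1) := fun h =>
      mem_gball_succ.mpr ⟨a, mem0, Or.inr h⟩
    have mem2 : ∀ {v}, v ∈ gball G a (k + 1) → v ∈ gball G a (k + 2) := fun h =>
      gball_mono_radius G a (Nat.le_succ _) h
    have hax : ¬ G.Adj a x := fun h => hx (mem2 (mem1 h))
    have hby : ¬ G.Adj b y := fun h => hy (mem_gball_succ.mpr ⟨b, mem1 hab, Or.inr h⟩)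
    have hxa : x ≠ a := fun h => hx (h ▸ self_mem_gball G a _)
    have hya : y ≠ a := fun h => hy (h ▸ self_mem_gball G a _)
    have hxb : x ≠ b := fun h => hx (h ▸ mem2 (mem1 hab))
    have hyb : y ≠ b := fun h => hy (h ▸ mem2 (mem1 hab))
    have hsw := hG.switchEdges hab hxy hax hby hxa hxb hya hyb
    simp only [hQ, regGraphs, Finset.coe_sigma, Set.mem_sigma_iff, Finset.mem_coe,
      Finset.mem_filter, Finset.mem_univ, true_and, Finset.mem_product, Finset.mem_sigma,
      mem_nbrs]
    refine ⟨hsw, ?_, gball_deleteEdges_subset_switchEdges hax hby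
      (fun h => hx (gball_mono_radius G a (by omega) h)) hb, ?_⟩
    · rw [switchEdges_adj]
      exact Or.inr ⟨⟨by simp, hxa.symm⟩, hax⟩
    · rw [switchEdges_adj]
      exact Or.inr ⟨⟨by simp, hyb.symm⟩, hby⟩
  · rintro ⟨G, ⟨a, b⟩, x, y⟩ _ ⟨G', ⟨a', b'⟩, x', y'⟩ _ h
    simp only [Sigma.mk.injEq, Prod.mk.injEq, heq_eq_eq] at h
    obtain ⟨h, rfl, rfl, rfl, rfl⟩ := h
    rw [switchEdges_injective _ _ _ _ h]

/-- The number of non-backtracking walks of length `k + 1` from `u` to `v` with first step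
to `w`. -/
noncomputable def nbCount (G : SimpleGraph V) : ℕ → V → V → V → ℕ
  | 0, u, w, v => if G.Adj u w ∧ w = v then 1 else 0
  | k + 1, u, w, v => if G.Adj u w then ∑ x ∈ Finset.univ.erase u, nbCount G k w x v else 0

theorem nbCount_eq_zero {G : SimpleGraph V} {u w : V} (h : ¬ G.Adj u w) (k : ℕ) (v : V) :
    nbCount G k u w v = 0 := by
  cases k <;> simp [nbCount, h]

theorem sum_nbCount_le {d : ℕ} {G : SimpleGraph V} (hG : NbrsCard d G) (k : ℕ) (u v : V)
    {M : ℕ} (hM : ∀ w, nbCount G k u w v ≤ M) : ∑ w, nbCount G k u w v ≤ d * M := by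
  rw [← hG u, ← smul_eq_mul]
  rw [← Finset.sum_subset (Finset.subset_univ (nbrs G u))
    fun w _ hw => nbCount_eq_zero (by simpa using hw) k v]
  exact Finset.sum_le_card_nsmul _ _ _ fun w _ => hM w

theorem nbCount_le {d : ℕ} {G : SimpleGraph V} (hG : NbrsCard d G) (k : ℕ) (u w v : V) :
    nbCount G k u w v ≤ d ^ k := by
  induction k generalizing u w with
  | zero => simp only [nbCount]; split_ifs <;> simp
  | succ k ih =>
    simp only [nbCount]
    split_ifs
    · rw [pow_succ']
      exact (Finset.sum_le_sum_of_subset (Finset.erase_subset _ _)).trans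
        (sum_nbCount_le hG k w v fun x => ih w x)
    · simp

theorem exists_walk_of_nbCount_ne_zero {G : SimpleGraph V} {k : ℕ} {u w v : V}
    (h : nbCount G k u w v ≠ 0) : ∃ p : ℕ → V, p 0 = u ∧ p 1 = w ∧ p (k + 1) = v ∧
      (∀ i ≤ k, G.Adj (p i) (p (i + 1))) ∧ ∀ i < k, p i ≠ p (i + 2) := by
  induction k generalizing u w with
  | zero =>
    simp only [nbCount, ne_eq, ite_eq_right_iff, one_ne_zero, imp_false, not_not] at h
    refine ⟨fun i => if i = 0 then u else w, by simp, by simp, by simpa using h.2, ?_, by simp⟩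
    intro i hi
    obtain rfl : i = 0 := by omega
    simpa using h.1
  | succ k ih =>
    simp only [nbCount, ne_eq, ite_eq_right_iff, not_forall] at h
    obtain ⟨huw, h⟩ := h
    obtain ⟨x, hx, hx0⟩ := Finset.exists_ne_zero_of_sum_ne_zero h
    obtain ⟨p, h0, h1, h2, h3, h4⟩ := ih hx0
    refine ⟨fun i => Nat.casesOn i u p, rfl, h0, h2, ?_, ?_⟩
    · rintro (_ | i) hi
      · simpa [h0] using huw
      · exact h3 i (by omega)
    · rintro (_ | i) hi
      · simpa [h1] using (Finset.ne_of_mem_erase hx).symm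
      · exact h4 i (by omega)

theorem exists_shortEdge_of_closed_walk {G : SimpleGraph V} {k : ℕ} (p : ℕ → V)
    (hc : p (k + 1) = p 0) (hp : ∀ i ≤ k, G.Adj (p i) (p (i + 1)))
    (hnb : ∀ i < k, p i ≠ p (i + 2)) :
    ∃ e ∈ shortEdges (k + 1) G, p 0 ∈ gball G e.1 (k + 1) := by
  have hex : ∃ m, 1 ≤ m ∧ ∃ i, i + m ≤ k + 1 ∧ p i = p (i + m) :=
    ⟨k + 1, by omega, 0, by omega, by simpa using hc.symm⟩
  obtain ⟨hm1, i, him, hpi⟩ := Nat.find_spec hex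
  have hmin : ∀ m' < Nat.find hex, 1 ≤ m' → ∀ j, j + m' ≤ k + 1 → p j ≠ p (j + m') :=
    fun m' hm' h1 j hj h => Nat.find_min hex hm' ⟨h1, j, hj, h⟩
  set m := Nat.find hex
  refine ⟨(p (i + 1), p i), ?_, ?_⟩
  · simp only [shortEdges, Finset.mem_filter, Finset.mem_univ, true_and]
    refine ⟨(hp i (by omega)).symm, ?_⟩
    have hend : p i = p (i + 1 + (m - 1)) := by rw [hpi]; congr 1; omega
    nth_rewrite 2 [hend]
    refine gball_mono_radius _ _ (show m - 1 ≤ k + 1 by omega) ?_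
    refine mem_gball_of_walk p (i + 1) (m - 1) fun j h1 h2 => ?_
    rw [SimpleGraph.deleteEdges_adj, Set.mem_singleton_iff, Sym2.eq_iff]
    refine ⟨hp j (by omega), ?_⟩
    rintro (⟨h3, h4⟩ | ⟨h3, h4⟩)
    · rcases Nat.eq_or_lt_of_le h1 with h | h
      · subst h
        exact hnb i (by omega) h4.symm
      · refine hmin (j - (i + 1)) (by omega) (by omega) (i + 1) (by omega) ?_
        rw [← h3]; congr 1; omega
    · refine hmin (j - i) (by omega) (by omega) i (by omega) ?_
      rw [← h3]; congr 1; omega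
  · rw [← hc]
    have := mem_gball_of_walk (G := G) p (i + 1) (k - i) fun j _ _ => hp j (by omega)
    rw [show i + 1 + (k - i) = k + 1 by omega] at this
    exact gball_mono_radius _ _ (by omega) this

theorem sum_nbCount_diag_le {d : ℕ} {G : SimpleGraph V} (hG : NbrsCard d G) (k : ℕ) :
    ∑ v, ∑ w, nbCount G k v w v ≤
      #(shortEdges (k + 1) G) * ((d + 1) ^ (k + 1) * (d * d ^ k)) := by
  set B := (shortEdges (k + 1) G).biUnion fun e => gball G e.1 (k + 1) with hB
  have hBc : #B ≤ #(shortEdges (k + 1) G) * (d + 1) ^ (k + 1) :=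
    Finset.card_biUnion_le_card_mul _ _ _ fun e _ => hG.card_gball_le _ _
  rw [← Finset.sum_subset (Finset.subset_univ B), ← mul_assoc]
  · refine (Finset.sum_le_card_nsmul _ _ (d * d ^ k) fun v _ =>
      sum_nbCount_le hG k v v fun w => nbCount_le hG k v w v).trans ?_
    exact Nat.mul_le_mul_right _ hBc
  · intro v _ hv
    refine Finset.sum_eq_zero fun w _ => ?_
    by_contra h
    obtain ⟨p, h0, -, h2, h3, h4⟩ := exists_walk_of_nbCount_ne_zero h
    obtain ⟨e, he, hv'⟩ := exists_shortEdge_of_closed_walk p (h2.trans h0.symm) h3 h4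
    exact hv (Finset.mem_biUnion.mpr ⟨e, he, h0 ▸ hv'⟩)

theorem nbCount_succ_cast (G : SimpleGraph V) (k : ℕ) (u w v : V) :
    (nbCount G (k + 1) u w v : ℝ) =
      G.adjMatrix ℝ u w * (∑ x, (nbCount G k w x v : ℝ) - nbCount G k w u v) := by
  rw [← Finset.sum_erase_eq_sub (Finset.mem_univ u), SimpleGraph.adjMatrix_apply, nbCount]
  split_ifs <;> simp

theorem NbrsCard.sum_adjMatrix {d : ℕ} {G : SimpleGraph V} (hG : NbrsCard d G) (u : V) :
    ∑ w, G.adjMatrix ℝ u w = d := by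
  rw [← hG u]
  simp [SimpleGraph.adjMatrix_apply, nbrs]

theorem adjMatrix_mul_nbCount (G : SimpleGraph V) (k : ℕ) (u w v : V) :
    G.adjMatrix ℝ u w * nbCount G k u w v = nbCount G k u w v := by
  rw [SimpleGraph.adjMatrix_apply]
  split_ifs with h
  · simp
  · simp [nbCount_eq_zero h]

theorem sum_nbCount_zero (G : SimpleGraph V) (u v : V) :
    ∑ w, (nbCount G 0 u w v : ℝ) = G.adjMatrix ℝ u v := by
  rw [Finset.sum_eq_single v]
  · simp [nbCount, SimpleGraph.adjMatrix_apply]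
  · intro w _ hw
    simp [nbCount, hw]
  · simp

open Polynomial in
theorem NbrsCard.aeval_nbPoly_apply [DecidableEq V] {d : ℕ} {G : SimpleGraph V}
    (hG : NbrsCard d G) (k : ℕ) (u v : V) : aeval (G.adjMatrix ℝ) (nbPoly (d - 1) (k + 1)) u v =
      ∑ w, (nbCount G k u w v : ℝ) := by
  have hsymm : ∀ u w, G.adjMatrix ℝ w u = G.adjMatrix ℝ u w := fun u w => by
    simp only [SimpleGraph.adjMatrix_apply, G.adj_comm]
  have hidem : ∀ u w, G.adjMatrix ℝ u w * G.adjMatrix ℝ u w = G.adjMatrix ℝ u w := fun u w => by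
    simp [SimpleGraph.adjMatrix_apply]
  induction k using Nat.twoStepInduction generalizing u v with
  | zero =>
    rw [sum_nbCount_zero, nbPoly, aeval_X]
  | one =>
    have h1 : ∀ w, G.adjMatrix ℝ u w * (nbCount G 0 w u v : ℝ) =
        G.adjMatrix ℝ u w * (1 : Matrix V V ℝ) u v := fun w => by
      rw [SimpleGraph.adjMatrix_apply]
      split_ifs with h
      · simp [nbCount, h.symm, Matrix.one_apply]
      · simp
    simp only [nbCount_succ_cast, sum_nbCount_zero, mul_sub, h1]
    rw [Finset.sum_sub_distrib, ← Finset.sum_mul, hG.sum_adjMatrix]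
    simp [nbPoly, pow_two, Matrix.mul_apply, ← Matrix.diagonal_natCast, Matrix.one_apply,
      Matrix.diagonal_apply]
  | more k ih1 ih2 =>
    have h1 : ∀ w, G.adjMatrix ℝ u w * (nbCount G (k + 1) w u v : ℝ) =
        G.adjMatrix ℝ u w * (∑ x, (nbCount G k u x v : ℝ)) - nbCount G k u w v := fun w => by
      rw [nbCount_succ_cast, hsymm u w, ← mul_assoc, hidem, mul_sub, adjMatrix_mul_nbCount]
    simp only [nbCount_succ_cast G (k + 1), mul_sub, h1]
    rw [Finset.sum_sub_distrib, Finset.sum_sub_distrib, ← Finset.sum_mul, hG.sum_adjMatrix,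
      ← ih1]
    simp only [← ih2]
    rw [show k + 2 + 1 = k + 3 from rfl, nbPoly, map_sub, map_mul, map_mul, aeval_X, aeval_C,
      Matrix.sub_apply, Matrix.mul_apply, ← Algebra.smul_def, Matrix.smul_apply, smul_eq_mul]
    ring

open Polynomial in
theorem NbrsCard.abs_trace_aeval_nbPoly_le [DecidableEq V] {d : ℕ} {G : SimpleGraph V}
    (hG : NbrsCard d G) (k : ℕ) : |(aeval (G.adjMatrix ℝ) (nbPoly (d - 1) (k + 1))).trace| ≤
      #(shortEdges (k + 1) G) * ((d + 1) ^ (k + 1) * (d * d ^ k)) := by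
  simp only [Matrix.trace, Matrix.diag, hG.aeval_nbPoly_apply]
  rw [abs_of_nonneg (by positivity)]
  exact_mod_cast sum_nbCount_diag_le hG k

open Polynomial in
/-- The deviation of the normalized trace of `P(A)` from the Kesten–McKay average of `P`. -/
noncomputable def traceDev (d : ℕ) {n : ℕ} (G : SimpleGraph (Fin n)) (P : ℝ[X]) : ℝ :=
  |(aeval (G.adjMatrix ℝ) P).trace / n - kmInt d fun x => P.eval (2 * x)|

open Polynomial in
/-- The mean of `traceDev` over the `d`-regular graphs on `n` vertices. -/
noncomputable def meanTraceDev (d : ℕ) (P : ℝ[X]) (n : ℕ) : ℝ :=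
  (∑ G ∈ regGraphs (Fin n) d, traceDev d G P) / #(regGraphs (Fin n) d)

open Polynomial in
theorem meanTraceDev_nonneg (d : ℕ) (P : ℝ[X]) (n : ℕ) : 0 ≤ meanTraceDev d P n :=
  div_nonneg (Finset.sum_nonneg fun _ _ => abs_nonneg _) (Nat.cast_nonneg _)

open Polynomial in
theorem traceDev_add_le {d : ℕ} (hd : 3 ≤ d) {n : ℕ} (G : SimpleGraph (Fin n)) (P Q : ℝ[X]) :
    traceDev d G (P + Q) ≤ traceDev d G P + traceDev d G Q := by
  have h : kmInt d (fun x => (P + Q).eval (2 * x)) =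
      kmInt d (fun x => P.eval (2 * x)) + kmInt d (fun x => Q.eval (2 * x)) := by
    simp only [kmInt]
    rw [← integral_add (integrableOn_mul_kmDensity hd (by fun_prop))
      (integrableOn_mul_kmDensity hd (by fun_prop))]
    simp only [eval_add, add_mul]
  rw [traceDev, h, map_add, Matrix.trace_add, add_div, add_sub_add_comm]
  exact abs_add_le _ _

open Polynomial in
theorem traceDev_smul (d : ℕ) {n : ℕ} (G : SimpleGraph (Fin n)) (c : ℝ) (P : ℝ[X]) :
    traceDev d G (c • P) = |c| * traceDev d G P := by
  have h : kmInt d (fun x => (c • P).eval (2 * x)) =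
      c * kmInt d (fun x => P.eval (2 * x)) := by
    simp only [kmInt]
    rw [← integral_const_mul]
    simp only [eval_smul, smul_eq_mul, mul_assoc]
  rw [traceDev, h, map_smul, Matrix.trace_smul, smul_eq_mul, mul_div_assoc, ← mul_sub, abs_mul]
  rfl

theorem tendsto_meanTraceDev_nbPoly_zero {d : ℕ} (hd : 3 ≤ d) :
    Tendsto (meanTraceDev d (nbPoly (d - 1) 0)) atTop (nhds 0) := by
  refine tendsto_const_nhds.congr' ?_
  filter_upwards [eventually_gt_atTop 0] with n hn
  have hn' : (n : ℝ) ≠ 0 := by exact_mod_cast hn.ne'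
  rw [meanTraceDev, Finset.sum_eq_zero, zero_div]
  intro G _
  simp [traceDev, nbPoly, kmInt_one hd, hn']

theorem sum_card_shortEdges_le {d : ℕ} (hd : 1 ≤ d) {k n : ℕ}
    (hn : 2 * (2 * ((d + 1) ^ (k + 2) * d)) ≤ n) :
    ∑ G ∈ regGraphs (Fin n) d, #(shortEdges k G) ≤
      #(regGraphs (Fin n) d) * (2 * (d * ((d + 1) ^ k * d))) := by
  have h := sum_card_shortEdges_mul_le (V := Fin n) d k
  rw [Fintype.card_fin] at h
  set S := ∑ G ∈ regGraphs (Fin n) d, #(shortEdges k G)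
  set K := 2 * ((d + 1) ^ (k + 2) * d) with hK
  have hK0 : 0 < K := by positivity
  have hn0 : 0 < n := by omega
  have h1 : 2 * (S * n) ≤ 2 * (S * (n * d)) :=
    Nat.mul_le_mul_left _ (Nat.mul_le_mul_left _ (Nat.le_mul_of_pos_right n hd))
  have h2 : S * (2 * K) ≤ S * n := Nat.mul_le_mul_left _ hn
  refine Nat.le_of_mul_le_mul_left ?_ hn0
  nlinarith

theorem tendsto_meanTraceDev_nbPoly_succ {d : ℕ} (hd : 3 ≤ d) (k : ℕ) :
    Tendsto (meanTraceDev d (nbPoly (d - 1) (k + 1))) atTop (nhds 0) := by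
  set C : ℝ := 2 * (d * ((d + 1) ^ (k + 1) * d)) * ((d + 1) ^ (k + 1) * (d * d ^ k)) with hC
  refine squeeze_zero' (Eventually.of_forall fun n => meanTraceDev_nonneg _ _ _) ?_
    (tendsto_const_div_atTop_nhds_zero_nat C)
  filter_upwards [eventually_ge_atTop (2 * (2 * ((d + 1) ^ (k + 1 + 2) * d)))] with n hn
  have hS : ((∑ G ∈ regGraphs (Fin n) d, #(shortEdges (k + 1) G) : ℕ) : ℝ) ≤
      #(regGraphs (Fin n) d) * (2 * (d * ((d + 1) ^ (k + 1) * d))) := by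
    exact_mod_cast sum_card_shortEdges_le (by omega) hn
  refine div_le_of_le_mul₀ (Nat.cast_nonneg _) (by positivity) ?_
  calc ∑ G ∈ regGraphs (Fin n) d, traceDev d G (nbPoly (d - 1) (k + 1))
      ≤ ∑ G ∈ regGraphs (Fin n) d,
        (#(shortEdges (k + 1) G) : ℝ) * (((d + 1) ^ (k + 1) * (d * d ^ k)) / n) := by
        refine Finset.sum_le_sum fun G hG => ?_
        have hG : NbrsCard d G := by simpa [regGraphs] using hG
        rw [traceDev, kmInt_nbPoly hd, sub_zero, abs_div, Nat.abs_cast, ← mul_div_assoc]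
        exact div_le_div_of_nonneg_right (hG.abs_trace_aeval_nbPoly_le k) (Nat.cast_nonneg _)
    _ ≤ #(regGraphs (Fin n) d) * (2 * (d * ((d + 1) ^ (k + 1) * d))) *
        (((d + 1) ^ (k + 1) * (d * d ^ k)) / n) := by
        rw [← Finset.sum_mul, ← Nat.cast_sum]
        exact mul_le_mul_of_nonneg_right hS (by positivity)
    _ = C / n * #(regGraphs (Fin n) d) := by rw [hC]; ring

open Polynomial in
theorem tendsto_meanTraceDev {d : ℕ} (hd : 3 ≤ d) (P : ℝ[X]) :
    Tendsto (meanTraceDev d P) atTop (nhds 0) := by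
  have hP : P ∈ Submodule.span ℝ (Set.range (nbPoly (d - 1))) := by
    rw [span_range_nbPoly]; trivial
  induction hP using Submodule.span_induction with
  | mem x hx =>
    obtain ⟨_ | k, rfl⟩ := hx
    · exact tendsto_meanTraceDev_nbPoly_zero hd
    · exact tendsto_meanTraceDev_nbPoly_succ hd k
  | zero =>
    have h : ∀ n (G : SimpleGraph (Fin n)), traceDev d G 0 = 0 := fun n G => by
      simp [traceDev, kmInt]
    refine tendsto_const_nhds.congr fun n => ?_
    simp [meanTraceDev, h]
  | add P Q _ _ hP hQ =>
    refine squeeze_zero (fun n => meanTraceDev_nonneg _ _ _) (fun n => ?_)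
      (by simpa using hP.add hQ)
    simp only [meanTraceDev]
    rw [← add_div, ← Finset.sum_add_distrib]
    exact div_le_div_of_nonneg_right
      (Finset.sum_le_sum fun G _ => traceDev_add_le hd G P Q) (Nat.cast_nonneg _)
  | smul c P _ hP =>
    refine Tendsto.congr (fun n => ?_) (by simpa using hP.const_mul |c|)
    simp only [meanTraceDev, traceDev_smul]
    rw [← Finset.mul_sum, mul_div_assoc]

theorem isReg_iff_nbrsCard {n d : ℕ} {G : SimpleGraph (Fin n)} : IsReg d G ↔ NbrsCard d G := by
  unfold IsReg NbrsCard SimpleGraph.IsRegularOfDegree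
  refine forall_congr' fun v => ?_
  rw [← SimpleGraph.card_neighborFinset_eq_degree, SimpleGraph.neighborFinset_eq_filter]
  rfl

open Polynomial in
theorem abs_kmInt_sub_le {d : ℕ} (hd : 3 ≤ d) {f : ℝ → ℝ} (hf : Continuous f) (P : ℝ[X]) {δ : ℝ}
    (hP : ∀ l ∈ Set.Icc (-(d : ℝ)) d, |P.eval l - rootReAvg (d - 1) f l| ≤ δ) :
    |kmInt d (fun x => P.eval (2 * x)) - kmInt d f| ≤ δ := by
  have h3 : (3 : ℝ) ≤ d := by exact_mod_cast hd
  have hi := integrableOn_mul_kmDensity hd (h := fun x => P.eval (2 * x)) (by fun_prop)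
  have hif := integrableOn_mul_kmDensity hd hf
  have hi1 := integrableOn_mul_kmDensity hd (h := fun _ => δ) continuous_const
  have h1 : kmInt d (fun _ => δ) = δ := by
    have := kmInt_one hd
    simp only [kmInt, one_mul] at this ⊢
    rw [integral_const_mul, this, mul_one]
  conv_rhs => rw [← h1]
  unfold kmInt at *
  rw [← integral_sub hi hif, ← Real.norm_eq_abs]
  refine norm_integral_le_of_norm_le hi1 ?_
  refine (ae_restrict_mem measurableSet_Icc).mono fun x hx => ?_
  have hx2 : x ^ 2 ≤ (d : ℝ) - 1 := by
    rw [← Real.sq_sqrt (show (0 : ℝ) ≤ (d : ℝ) - 1 by linarith)]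
    exact sq_le_sq' hx.1 hx.2
  have hmem : 2 * x ∈ Set.Icc (-(d : ℝ)) d := by
    rw [Set.mem_Icc, ← abs_le]
    exact abs_le_of_sq_le_sq (by nlinarith) (by linarith)
  have hfx : rootReAvg (d - 1) f (2 * x) = f x := by
    rw [rootReAvg_of_sq_le f (by linarith)]
    congr 1
    ring
  rw [← sub_mul, norm_mul, Real.norm_eq_abs, Real.norm_eq_abs,
    abs_of_nonneg (kmDensity_nonneg hd hx), ← hfx]
  exact mul_le_mul_of_nonneg_right (hP _ hmem) (kmDensity_nonneg hd hx)

open Polynomial in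
theorem abs_empAvgRe_sub_le {n d : ℕ} {G : SimpleGraph (Fin n)} (hG : IsReg d G) {f : ℝ → ℝ}
    (P : ℝ[X]) {δ : ℝ} (hδ : 0 ≤ δ)
    (hP : ∀ l ∈ Set.Icc (-(d : ℝ)) d, |P.eval l - rootReAvg (d - 1) f l| ≤ δ) :
    |empAvgRe d G f - (aeval (G.adjMatrix ℝ) P).trace / n| ≤ δ := by
  have hA : (G.adjMatrix ℝ).IsHermitian := by
    rw [Matrix.IsHermitian, Matrix.conjTranspose_eq_transpose_of_trivial,
      SimpleGraph.transpose_adjMatrix]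
  rw [empAvgRe_eq d G f hA, hA.trace_aeval_eq_sum, ← sub_div, ← Finset.sum_sub_distrib, abs_div,
    Nat.abs_cast]
  refine div_le_of_le_mul₀ (Nat.cast_nonneg _) hδ ?_
  refine (Finset.abs_sum_le_sum_abs _ _).trans ?_
  refine (Finset.sum_le_card_nsmul _ _ δ fun i _ => ?_).trans (by simp [mul_comm])
  rw [abs_sub_comm]
  exact hP _ (abs_le.mp (abs_eigenvalue_adjMatrix_le hG hA i))

theorem mem_regGraphs_iff_isReg {n d : ℕ} {G : SimpleGraph (Fin n)} :
    G ∈ regGraphs (Fin n) d ↔ IsReg d G := by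
  simp [regGraphs, isReg_iff_nbrsCard]

theorem natCard_isReg (n d : ℕ) :
    Nat.card {G : SimpleGraph (Fin n) // IsReg d G} = (regGraphs (Fin n) d).card :=
  Nat.subtype_card _ fun _ => mem_regGraphs_iff_isReg

theorem half_le_traceDev {n d : ℕ} (hd : 3 ≤ d) {G : SimpleGraph (Fin n)} (hreg : IsReg d G)
    {f : ℝ → ℝ} (hf : Continuous f) {ε : ℝ} (hε : 0 < ε) (P : Polynomial ℝ)
    (hP : ∀ l ∈ Set.Icc (-(d : ℝ)) d, |P.eval l - rootReAvg (d - 1) f l| ≤ ε / 4)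
    (hdev : ε < |empAvgRe d G f - kmInt d f|) : ε / 2 ≤ traceDev d G P := by
  have h1 := abs_kmInt_sub_le hd hf P hP
  have h2 := abs_empAvgRe_sub_le hreg P (by linarith) hP
  unfold traceDev
  have h4 := abs_sub_le (empAvgRe d G f) ((Polynomial.aeval (G.adjMatrix ℝ) P).trace / n)
    (kmInt d f)
  have h5 := abs_sub_le ((Polynomial.aeval (G.adjMatrix ℝ) P).trace / n)
    (kmInt d fun x => P.eval (2 * x)) (kmInt d f)
  linarith

theorem natCard_deviation_le {d : ℕ} (hd : 3 ≤ d) (n : ℕ) {f : ℝ → ℝ} (hf : Continuous f) {ε : ℝ}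
    (hε : 0 < ε) (P : Polynomial ℝ)
    (hP : ∀ l ∈ Set.Icc (-(d : ℝ)) d, |P.eval l - rootReAvg (d - 1) f l| ≤ ε / 4) :
    (Nat.card {G : SimpleGraph (Fin n) // IsReg d G ∧ ε < |empAvgRe d G f - kmInt d f|} : ℝ) ≤
      2 / ε * ∑ G ∈ regGraphs (Fin n) d, traceDev d G P := by
  rw [Nat.subtype_card ((regGraphs (Fin n) d).filter fun G => ε < |empAvgRe d G f - kmInt d f|)
    fun G => by rw [Finset.mem_filter, mem_regGraphs_iff_isReg], Finset.mul_sum, ← nsmul_one,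
    ← Finset.sum_const]
  refine (Finset.sum_le_sum fun G hG => ?_).trans
    (Finset.sum_le_sum_of_subset_of_nonneg (Finset.filter_subset _ _) fun G _ _ =>
      mul_nonneg (by positivity) (abs_nonneg _))
  obtain ⟨hreg, hdev⟩ := Finset.mem_filter.mp hG
  calc (1 : ℝ) = 2 / ε * (ε / 2) := by field_simp
    _ ≤ 2 / ε * traceDev d G P := mul_le_mul_of_nonneg_left
      (half_le_traceDev hd (mem_regGraphs_iff_isReg.mp hreg) hf hε P hP hdev) (by positivity)

theorem tendsto_deviation_probability {d : ℕ} (hd : 3 ≤ d) {f : ℝ → ℝ} (hf : Continuous f) {ε : ℝ}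
    (hε : 0 < ε) :
    Tendsto (fun n : ℕ =>
      (Nat.card {G : SimpleGraph (Fin n) // IsReg d G ∧ ε < |empAvgRe d G f - kmInt d f|} : ℝ) /
        (Nat.card {G : SimpleGraph (Fin n) // IsReg d G} : ℝ)) atTop (nhds 0) := by
  obtain ⟨P, hP⟩ := exists_polynomial_near_of_continuousOn (-(d : ℝ)) d
    (rootReAvg (d - 1) f) (continuous_rootReAvg ((d : ℝ) - 1) hf).continuousOn (ε / 4)
    (by linarith)
  refine squeeze_zero (fun n => div_nonneg (Nat.cast_nonneg _) (Nat.cast_nonneg _)) (fun n => ?_)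
    (by simpa using (tendsto_meanTraceDev hd P).const_mul (2 / ε))
  rw [natCard_isReg, meanTraceDev, ← mul_div_assoc]
  exact div_le_div_of_nonneg_right
    (natCard_deviation_le hd n hf hε P fun l hl => (hP l hl).le) (Nat.cast_nonneg _)

end Graph

/-- Theorem 3.1(1): for fixed `d ≥ 3`, the empirical measure of the real
parts of the eigenvalues of the reduced non-backtracking matrix of a uniformly random
`d`-regular graph converges weakly in probability to the rescaled Kesten–McKay law with
density `2d√((d−1) − x²)/(π(d² − 4x²))` on `{|x| ≤ √(d−1)}`: for every bounded continuous
`f` and every `ε > 0`, the probability (uniform over `d`-regular graphs on `n` vertices)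
that the empirical average of `f` deviates from `∫ f dμ_KM` by more than `ε` tends to `0`.
(For `n` with `nd` odd there are no `d`-regular graphs and the ratio is `0/0 = 0`.) -/
theorem kesten_mckay_real_parts (d : ℕ) (hd : 3 ≤ d) (f : ℝ → ℝ) (hf : Continuous f)
    (hb : ∃ M : ℝ, ∀ x, |f x| ≤ M) (ε : ℝ) (hε : 0 < ε) :
    Tendsto (fun n : ℕ =>
      (Nat.card {G : SimpleGraph (Fin n) // IsReg d G ∧
          ε < |empAvgRe d G f -
            ∫ x in Set.Icc (-(Real.sqrt ((d : ℝ) - 1))) (Real.sqrt ((d : ℝ) - 1)),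
              f x * (2 * (d : ℝ) * Real.sqrt (((d : ℝ) - 1) - x ^ 2) /
                (Real.pi * ((d : ℝ) ^ 2 - 4 * x ^ 2)))|} : ℝ) /
        (Nat.card {G : SimpleGraph (Fin n) // IsReg d G} : ℝ))
      atTop (nhds 0) := by
  exact tendsto_deviation_probability hd hf hε
end

section
/- Let G = (V, E) be a d-regular simple graph with d ≥ 2 and adjacency matrix A, and let \vec E = {(u,v) : {u,v} ∈ E} be its oriented edge set. Suppose v ∈ ℂ^V satisfies A v = λ v, and μ ∈ ℂ satisfies μ² − λμ + (d−1) = 0. Define w ∈ ℂ^{\vec E} by w(x,y) = μ·v(y) − v(x) for each oriented edge (x,y) ∈ \vec E. Then B w = μ w, where B is the non-backtracking operator of G. -/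
open Matrix

/-- The non-backtracking operator `B` of a graph `G`, acting on the oriented edges
`\vec E = {(u,v) : {u,v} ∈ E}`: `B_{(u,v),(x,y)} = 1` iff `v = x` and `u ≠ y`. -/
def nbMatrix {V : Type*} [DecidableEq V] (G : SimpleGraph V) :
    Matrix {p : V × V // G.Adj p.1 p.2} {p : V × V // G.Adj p.1 p.2} ℂ :=
  fun e f =>
    if (e : V × V).2 = (f : V × V).1 ∧ (e : V × V).1 ≠ (f : V × V).2 then 1 else 0

/-- `B` maps a function on oriented edges to its sum over non-backtracking continuations. -/
theorem nbMatrix_mulVec_apply {V : Type*} [Fintype V] [DecidableEq V]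
    (G : SimpleGraph V) [DecidableRel G.Adj] (f : V × V → ℂ)
    (e : {p : V × V // G.Adj p.1 p.2}) :
    (nbMatrix G).mulVec (fun p => f p) e =
      ∑ z ∈ (G.neighborFinset e.1.2).erase e.1.1, f (e.1.2, z) := by
  have hsub : (nbMatrix G).mulVec (fun p => f p) e =
      ∑ p ∈ Finset.univ.filter (fun p : V × V => G.Adj p.1 p.2),
        if e.1.2 = p.1 ∧ e.1.1 ≠ p.2 then f p else 0 := by
    have h := Finset.sum_subtype (p := fun p : V × V => G.Adj p.1 p.2)
      (F := inferInstance) (Finset.univ.filter fun p : V × V => G.Adj p.1 p.2) (by simp)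
      (fun p => if e.1.2 = p.1 ∧ e.1.1 ≠ p.2 then f p else 0)
    rw [h]
    simp [Matrix.mulVec, dotProduct, nbMatrix]
  rw [hsub, ← Finset.sum_filter]
  symm
  refine Finset.sum_bij (fun z _ => (e.1.2, z)) ?_ ?_ ?_ ?_
  · intro z hz
    simp only [Finset.mem_erase, SimpleGraph.mem_neighborFinset] at hz
    simp [hz.2, Ne.symm hz.1]
  · intro a _ b _ hab
    exact (Prod.mk.inj hab).2
  · rintro ⟨a, b⟩ hab
    simp only [Finset.mem_filter, Finset.mem_univ, true_and] at hab
    obtain ⟨hadj, rfl, hne⟩ := hab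
    exact ⟨b, by simp [hadj, Ne.symm hne], rfl⟩
  · intros
    rfl

/-- Lemma 6.1 / Remark 3.4 in Lubetzky–Peres.
Let `G` be a `d`-regular simple graph (`d ≥ 2`) with adjacency matrix `A`.  If `A v = λ v`
and `μ² − λμ + (d−1) = 0`, then the vector `w(x,y) = μ·v(y) − v(x)` on oriented edges
satisfies `B w = μ w`. -/
theorem nb_eigenvector_of_adj_eigenvector {V : Type*} [Fintype V] [DecidableEq V]
    (G : SimpleGraph V) [DecidableRel G.Adj] (d : ℕ) (hd : 2 ≤ d)
    (hreg : G.IsRegularOfDegree d) (v : V → ℂ) (lam μ : ℂ)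
    (hv : (G.adjMatrix ℂ).mulVec v = lam • v)
    (hμ : μ ^ 2 - lam * μ + ((d : ℂ) - 1) = 0)
    (w : {p : V × V // G.Adj p.1 p.2} → ℂ)
    (hw : w = fun e => μ * v e.1.2 - v e.1.1) :
    (nbMatrix G).mulVec w = μ • w := by
  subst hw
  ext e
  have hx : e.1.1 ∈ G.neighborFinset e.1.2 := by
    simpa using e.2.symm
  have hsum : ∑ z ∈ G.neighborFinset e.1.2, v z = lam * v e.1.2 := by
    simpa [SimpleGraph.adjMatrix_mulVec_apply] using congrFun hv e.1.2
  have hcard : (G.neighborFinset e.1.2).card = d := by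
    rw [SimpleGraph.card_neighborFinset_eq_degree, hreg e.1.2]
  rw [nbMatrix_mulVec_apply G (fun p => μ * v p.2 - v p.1), Finset.sum_erase_eq_sub hx,
    Finset.sum_sub_distrib, ← Finset.mul_sum, hsum]
  simp only [Finset.sum_const, hcard, nsmul_eq_mul, Pi.smul_apply, smul_eq_mul]
  linear_combination -v e.1.2 * hμ
end

section
/- Let H = (V, E) be a k-uniform, d-regular hypergraph on n vertices with d ≥ 2, adjacency matrix A, and reduced non-backtracking matrix \tilde B = [[0, (d−1)I_n], [−(k−1)I_n, A − (k−2)I_n]] ∈ ℂ^{2n×2n}. Suppose v ∈ ℂ^n is nonzero with A v = λ v, and μ ∈ ℂ satisfies μ² − (λ − k + 2)μ + (d−1)(k−1) = 0. Then the vector u = (v, (μ/(d−1))·v) ∈ ℂ^{2n} is nonzero and satisfies \tilde B u = μ u. -/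
open Matrix

/-- The adjacency matrix of a hypergraph with hyperedge set `E`: `A i j` is the number of
hyperedges containing both `i` and `j` for `i ≠ j`, and `A i i = 0`. -/
def hyperAdj {V : Type*} [Fintype V] [DecidableEq V] (E : Finset (Finset V)) :
    Matrix V V ℂ :=
  fun i j => if i = j then 0 else ((E.filter fun e => i ∈ e ∧ j ∈ e).card : ℂ)

/-- Lemma 7.1: for a `k`-uniform `d`-regular hypergraph (`d ≥ 2`) with
adjacency matrix `A` and reduced non-backtracking matrix
`\tilde B = [[0, (d−1)I], [−(k−1)I, A − (k−2)I]]`, if `v ≠ 0` with `A v = λ v` and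
`μ² − (λ − k + 2)μ + (d−1)(k−1) = 0`, then `u = (v, (μ/(d−1))·v)` is nonzero and
`\tilde B u = μ u`. -/
theorem hyper_tildeB_eigenvector {V : Type*} [Fintype V] [DecidableEq V]
    (E : Finset (Finset V)) (d k : ℕ) (hd : 2 ≤ d)
    (hunif : ∀ e ∈ E, e.card = k)
    (hreg : ∀ i : V, (E.filter fun e => i ∈ e).card = d)
    (v : V → ℂ) (hv : v ≠ 0) (lam μ : ℂ)
    (hev : (hyperAdj E).mulVec v = lam • v)
    (hμ : μ ^ 2 - (lam - (k : ℂ) + 2) * μ + ((d : ℂ) - 1) * ((k : ℂ) - 1) = 0) :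
    Sum.elim v ((μ / ((d : ℂ) - 1)) • v) ≠ 0 ∧
    (Matrix.fromBlocks 0 (((d : ℂ) - 1) • (1 : Matrix V V ℂ))
        ((-((k : ℂ) - 1)) • (1 : Matrix V V ℂ))
        (hyperAdj E - ((k : ℂ) - 2) • (1 : Matrix V V ℂ))).mulVec
      (Sum.elim v ((μ / ((d : ℂ) - 1)) • v))
      = μ • Sum.elim v ((μ / ((d : ℂ) - 1)) • v) := by
  have hd1 : (d : ℂ) - 1 ≠ 0 := by
    rw [sub_ne_zero]
    exact_mod_cast (by omega : d ≠ 1)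
  refine ⟨fun h => hv (funext fun i => congrFun h (Sum.inl i)), ?_⟩
  rw [Matrix.fromBlocks_mulVec]
  funext x
  rcases x with i | i
  · simp [Matrix.smul_mulVec]
    field_simp
  · simp [Matrix.smul_mulVec, Matrix.sub_mulVec, Matrix.mulVec_smul, hev]
    field_simp
    linear_combination (-v i) * hμ
end

section
/- Let H = (V, E) be a k-uniform, d-regular hypergraph with adjacency matrix A, and let \vec E = {(i, e) : i ∈ V, e ∈ E, i ∈ e} be its set of oriented hyperedges. Suppose v ∈ ℂ^V satisfies A v = λ v, and μ ∈ ℂ satisfies μ² − (λ − k + 2)μ + (d−1)(k−1) = 0. Define w ∈ ℂ^{\vec E} by w(x, e) = μ·(Σ_{y ∈ e, y ≠ x} v(y)) − (k−1)·v(x) for each (x, e) ∈ \vec E. Then B w = μ w, where B is the non-backtracking operator of H. -/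
open Matrix

/-- The non-backtracking operator `B` of a hypergraph with hyperedge set `E`, indexed by
oriented hyperedges `\vec E = {(i,e) : i ∈ e ∈ E}`:
`B_{(i,e),(j,f)} = 1` iff `j ∈ e∖{i}` and `f ≠ e`. -/
def hyperNB {V : Type*} [DecidableEq V] (E : Finset (Finset V)) :
    Matrix {p : V × Finset V // p.2 ∈ E ∧ p.1 ∈ p.2}
      {p : V × Finset V // p.2 ∈ E ∧ p.1 ∈ p.2} ℂ :=
  fun a b => if b.1.1 ∈ a.1.2 ∧ b.1.1 ≠ a.1.1 ∧ b.1.2 ≠ a.1.2 then 1 else 0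

/-- Applying the non-backtracking operator is summing over the oriented hyperedges `(j, f)` with
`j ∈ e ∖ {i}` and `f ≠ e`. -/
theorem hyperNB_mulVec_apply {V : Type*} [Fintype V] [DecidableEq V] (E : Finset (Finset V))
    (g : V → Finset V → ℂ) (a : {p : V × Finset V // p.2 ∈ E ∧ p.1 ∈ p.2}) :
    (hyperNB E).mulVec (fun b => g b.1.1 b.1.2) a =
      ∑ j ∈ a.1.2.erase a.1.1, ∑ f ∈ (E.filter fun f => j ∈ f).erase a.1.2, g j f := by
  obtain ⟨⟨i, e⟩, ha⟩ := a
  simp only [mulVec, dotProduct, hyperNB]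
  rw [← Finset.sum_subtype (Finset.univ.filter fun p : V × Finset V => p.2 ∈ E ∧ p.1 ∈ p.2)
    (by simp) (fun p : V × Finset V =>
      (if p.1 ∈ e ∧ p.1 ≠ i ∧ p.2 ≠ e then (1 : ℂ) else 0) * g p.1 p.2)]
  simp only [ite_mul, one_mul, zero_mul]
  rw [← Finset.sum_filter, Finset.filter_filter]
  refine (Finset.sum_finset_product' _ _ _ ?_).trans rfl
  rintro ⟨j, f⟩
  simp only [Finset.mem_filter, Finset.mem_univ, true_and, Finset.mem_erase]
  tauto

/-- The adjacency matrix sums a vector over all neighbours, hyperedge by hyperedge. -/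
theorem hyperAdj_mulVec_apply {V : Type*} [Fintype V] [DecidableEq V] (E : Finset (Finset V))
    (v : V → ℂ) (i : V) :
    (hyperAdj E).mulVec v i = ∑ f ∈ E.filter (fun f => i ∈ f), ∑ z ∈ f.erase i, v z := by
  have h : ∑ f ∈ E.filter (fun f => i ∈ f), ∑ z ∈ f.erase i, v z =
      ∑ z ∈ Finset.univ.erase i, ∑ f ∈ E.filter (fun f => i ∈ f ∧ z ∈ f), v z := by
    refine Finset.sum_comm' fun f z => ?_
    simp only [Finset.mem_filter, Finset.mem_univ, Finset.mem_erase]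
    tauto
  rw [h]
  simp only [mulVec, dotProduct, hyperAdj, Finset.sum_const, nsmul_eq_mul, ite_mul, zero_mul]
  rw [← Finset.add_sum_erase _ _ (Finset.mem_univ i), if_pos rfl, zero_add]
  exact Finset.sum_congr rfl fun z hz => if_neg (Finset.ne_of_mem_erase hz).symm

/-- Lemma 7.2, eigenvectors of `B` for regular hypergraphs.
For a `k`-uniform `d`-regular hypergraph with adjacency matrix `A`, if `A v = λ v` and
`μ² − (λ − k + 2)μ + (d−1)(k−1) = 0`, then the vector
`w(x,e) = μ·(∑_{y ∈ e, y ≠ x} v(y)) − (k−1)·v(x)` on oriented hyperedges satisfies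
`B w = μ w`. -/
theorem hyper_nb_eigenvector {V : Type*} [Fintype V] [DecidableEq V]
    (E : Finset (Finset V)) (d k : ℕ)
    (hunif : ∀ e ∈ E, e.card = k)
    (hreg : ∀ i : V, (E.filter fun e => i ∈ e).card = d)
    (v : V → ℂ) (lam μ : ℂ)
    (hev : (hyperAdj E).mulVec v = lam • v)
    (hμ : μ ^ 2 - (lam - (k : ℂ) + 2) * μ + ((d : ℂ) - 1) * ((k : ℂ) - 1) = 0)
    (w : {p : V × Finset V // p.2 ∈ E ∧ p.1 ∈ p.2} → ℂ)
    (hw : w = fun a => μ * (∑ y ∈ a.1.2.erase a.1.1, v y) - ((k : ℂ) - 1) * v a.1.1) :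
    (hyperNB E).mulVec w = μ • w := by
  subst hw
  funext a
  rw [hyperNB_mulVec_apply E
    (fun x e => μ * (∑ y ∈ e.erase x, v y) - ((k : ℂ) - 1) * v x) a]
  obtain ⟨⟨x, e⟩, he, hx⟩ := a
  dsimp only at he hx
  simp only [Pi.smul_apply, smul_eq_mul]
  have inner_sum : ∀ y ∈ e.erase x, ∑ f ∈ (E.filter fun f => y ∈ f).erase e,
      (μ * (∑ z ∈ f.erase y, v z) - ((k : ℂ) - 1) * v y) =
      (μ * (lam + 1) - ((d : ℂ) - 1) * ((k : ℂ) - 1)) * v y - μ * ∑ z ∈ e, v z := by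
    intro y hy
    have hye : y ∈ e := Finset.mem_of_mem_erase hy
    have hadj := (hyperAdj_mulVec_apply E v y).symm.trans (congrFun hev y)
    have hcard : ∑ _f ∈ E.filter (fun f => y ∈ f), ((k : ℂ) - 1) * v y =
        d * (((k : ℂ) - 1) * v y) := by
      rw [Finset.sum_const, hreg, nsmul_eq_mul]
    rw [Finset.sum_erase_eq_sub (Finset.mem_filter.2 ⟨he, hye⟩), Finset.sum_sub_distrib,
      ← Finset.mul_sum, hadj, hcard, Finset.sum_erase_eq_sub hye, Pi.smul_apply, smul_eq_mul]
    ring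
  have hk : ((e.erase x).card : ℂ) = k - 1 := by
    rw [Finset.cast_card_erase_of_mem hx, hunif e he]
  rw [Finset.sum_congr rfl inner_sum, Finset.sum_sub_distrib, ← Finset.mul_sum, Finset.sum_const,
    nsmul_eq_mul, hk, ← Finset.add_sum_erase e v hx]
  linear_combination (-∑ y ∈ e.erase x, v y) * hμ
end

section
/- Let n be even, let σ ∈ {−1, 1}^n take each value exactly n/2 times, and let G be a simple graph on n vertices such that every vertex i has exactly d₁ neighbors j with σ_j = σ_i and exactly d₂ neighbors j with σ_j = −σ_i, with d₁ + d₂ ≥ 2 and (d₁ − d₂)² > 4(d₁ + d₂ − 1). Let A be the adjacency matrix of G and \tilde B = [[0, (d₁+d₂−1)I_n], [−I_n, A]] ∈ ℝ^{2n×2n}. Then the two real numbers μ₂, μ₂' = (d₁ − d₂ ± √((d₁−d₂)² − 4(d₁+d₂−1)))/2 are eigenvalues of \tilde B, with respective eigenvectors v₂ = (σ, (μ₂/(d₁+d₂−1))·σ) ∈ ℝ^{2n} and v₂' = (σ, (μ₂'/(d₁+d₂−1))·σ) ∈ ℝ^{2n}. -/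
open Matrix

/-- If every vertex has `d₁` neighbors of its own sign and `d₂` of the opposite sign, then the sign
vector is an eigenvector of the adjacency matrix with eigenvalue `d₁ - d₂`. -/
theorem adjMatrix_mulVec_sign {V : Type*} [Fintype V] [DecidableEq V]
    (G : SimpleGraph V) [DecidableRel G.Adj] (σ : V → ℝ) (hσ : ∀ i, σ i = 1 ∨ σ i = -1) (d₁ d₂ : ℕ)
    (hdeg₁ : ∀ i, ((G.neighborFinset i).filter fun j => σ j = σ i).card = d₁)
    (hdeg₂ : ∀ i, ((G.neighborFinset i).filter fun j => σ j = -σ i).card = d₂) :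
    (G.adjMatrix ℝ).mulVec σ = ((d₁ : ℝ) - (d₂ : ℝ)) • σ := by
  ext i
  have hsplit : ∀ j, σ j = (if σ j = σ i then σ i else 0) - (if σ j = -σ i then σ i else 0) := by
    intro j
    rcases hσ i with hi | hi <;> rcases hσ j with hj | hj <;> rw [hi, hj] <;> norm_num
  rw [SimpleGraph.adjMatrix_mulVec_apply, Finset.sum_congr rfl fun j _ => hsplit j,
    Finset.sum_sub_distrib, ← Finset.sum_filter, ← Finset.sum_filter, Finset.sum_const,
    Finset.sum_const, hdeg₁, hdeg₂]
  simp only [nsmul_eq_mul, Pi.smul_apply, smul_eq_mul]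
  ring

/-- An eigenvector `v` of `A` with eigenvalue `l` lifts to an eigenvector of the block matrix
`[[0, q I], [-I, A]]` for each root `μ` of `μ² - l μ + q`. -/
theorem fromBlocks_mulVec_sumElim_of_root {V : Type*} [Fintype V] [DecidableEq V]
    (A : Matrix V V ℝ) (v : V → ℝ) (l q μ : ℝ) (hA : A.mulVec v = l • v) (hq : q ≠ 0)
    (hμ : μ ^ 2 - l * μ + q = 0) :
    (Matrix.fromBlocks 0 (q • (1 : Matrix V V ℝ)) (-1) A).mulVec (Sum.elim v ((μ / q) • v))
      = μ • Sum.elim v ((μ / q) • v) := by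
  rw [Matrix.fromBlocks_mulVec]
  ext (i | i)
  · simp [Matrix.smul_mulVec]
    field_simp
  · simp [Matrix.mulVec_smul, Matrix.neg_mulVec, hA]
    field_simp
    linear_combination -v i * hμ

/-- Theorem 3.8(2): for a realization `G` of the `(n, d₁, d₂)`-regular
stochastic block model with community assignment `σ ∈ {−1,1}^n`, if
`(d₁−d₂)² > 4(d₁+d₂−1)` then the two real numbers
`μ₂, μ₂' = (d₁−d₂ ± √((d₁−d₂)² − 4(d₁+d₂−1)))/2` are eigenvalues of
`\tilde B = [[0, (d₁+d₂−1)I], [−I, A]]`, with eigenvectors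
`v₂ = (σ, (μ₂/(d₁+d₂−1))·σ)` and `v₂' = (σ, (μ₂'/(d₁+d₂−1))·σ)`. -/
theorem rsbm_informative_eigenvectors (n d₁ d₂ : ℕ) (hn : Even n)
    (σ : Fin n → ℝ) (hσ : ∀ i, σ i = 1 ∨ σ i = -1)
    (hbal₁ : 2 * (Finset.univ.filter fun i : Fin n => σ i = 1).card = n)
    (hbal₂ : 2 * (Finset.univ.filter fun i : Fin n => σ i = -1).card = n)
    (G : SimpleGraph (Fin n)) [DecidableRel G.Adj]
    (hdeg₁ : ∀ i, ((G.neighborFinset i).filter fun j => σ j = σ i).card = d₁)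
    (hdeg₂ : ∀ i, ((G.neighborFinset i).filter fun j => σ j = -σ i).card = d₂)
    (hd : 2 ≤ d₁ + d₂)
    (hgap : 4 * ((d₁ : ℝ) + (d₂ : ℝ) - 1) < ((d₁ : ℝ) - (d₂ : ℝ)) ^ 2)
    (μ₂ μ₂' : ℝ)
    (hμ₂ : μ₂ = ((d₁ : ℝ) - (d₂ : ℝ) +
      Real.sqrt (((d₁ : ℝ) - (d₂ : ℝ)) ^ 2 - 4 * ((d₁ : ℝ) + (d₂ : ℝ) - 1))) / 2)
    (hμ₂' : μ₂' = ((d₁ : ℝ) - (d₂ : ℝ) -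
      Real.sqrt (((d₁ : ℝ) - (d₂ : ℝ)) ^ 2 - 4 * ((d₁ : ℝ) + (d₂ : ℝ) - 1))) / 2) :
    (Matrix.fromBlocks 0 (((d₁ : ℝ) + (d₂ : ℝ) - 1) • (1 : Matrix (Fin n) (Fin n) ℝ)) (-1)
        (G.adjMatrix ℝ)).mulVec
        (Sum.elim σ ((μ₂ / ((d₁ : ℝ) + (d₂ : ℝ) - 1)) • σ))
      = μ₂ • Sum.elim σ ((μ₂ / ((d₁ : ℝ) + (d₂ : ℝ) - 1)) • σ) ∧
    (Matrix.fromBlocks 0 (((d₁ : ℝ) + (d₂ : ℝ) - 1) • (1 : Matrix (Fin n) (Fin n) ℝ)) (-1)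
        (G.adjMatrix ℝ)).mulVec
        (Sum.elim σ ((μ₂' / ((d₁ : ℝ) + (d₂ : ℝ) - 1)) • σ))
      = μ₂' • Sum.elim σ ((μ₂' / ((d₁ : ℝ) + (d₂ : ℝ) - 1)) • σ) := by
  have hd' : (2 : ℝ) ≤ (d₁ : ℝ) + d₂ := by exact_mod_cast hd
  have hA := adjMatrix_mulVec_sign G σ hσ d₁ d₂ hdeg₁ hdeg₂
  have hq : (d₁ : ℝ) + (d₂ : ℝ) - 1 ≠ 0 := by linarith
  have hs := Real.sq_sqrt (sub_nonneg.mpr hgap.le)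
  constructor
  · refine fromBlocks_mulVec_sumElim_of_root _ _ _ _ _ hA hq ?_
    rw [hμ₂]
    linear_combination hs / 4
  · refine fromBlocks_mulVec_sumElim_of_root _ _ _ _ _ hA hq ?_
    rw [hμ₂']
    linear_combination hs / 4
end
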